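/- arXiv:2302.10378 — 11 statements merged into one kernel-verified Lean document; each statement's English description precedes it below -/
import Mathlib

section
/- Let n ≥ 2 and 1 ≤ l < n be integers, let U ⊆ ℝ^{n-l} be a connected bounded open set, and let g = (g_1,…,g_l) : U → ℝ^l be a C² map; let M = {(x, g(x)) : x ∈ U} ⊆ ℝⁿ and let θ ∈ ℝ. Let Ψ : ℤⁿ → [0,∞) be a multivariable approximating function. Let f be a dimension function satisfying condition (I): there exist a real s < 2(n−l−1) and a constant C > 0 such that f(xy) ≤ C·x^s·f(y) for all 0 < y < 1 < x. Assume g satisfies condition (II): there is a set S ⊆ U with H^f(S) = 0 such that for every nonzero s = (s_1,…,s_l) ∈ ℝ^l and every x ∈ U \ S, the symmetric (n−l)×(n−l) matrix Λ(g,s,x) with (j,i) entry ∑_{u=1}^{l} s_u · ∂²g_u/∂x_i∂x_j (x) is invertible. Then: if the series ∑_{q ∈ ℤⁿ\{0}} ‖q‖^{n−l} Ψ(q)^{l+1−n} f(Ψ(q)/‖q‖) converges, then H^f(D_n^θ(Ψ) ∩ M) = 0. -/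
open MeasureTheory Filter

noncomputable section

/-- Sup norm `‖q‖ = max |q_i|` of an integer vector. -/
def zNorm {n : ℕ} (q : Fin n → ℤ) : ℝ :=
  ((Finset.univ.sup fun i => (q i).natAbs : ℕ) : ℝ)

/-- The set `D_n^θ(Ψ)` of `(Ψ,θ)`-approximable points. -/
def dualApprox (n : ℕ) (θ : ℝ) (Ψ : (Fin n → ℤ) → ℝ) : Set (Fin n → ℝ) :=
  { x | { pq : ℤ × (Fin n → ℤ) |
      |(∑ i, (pq.2 i : ℝ) * x i) + (pq.1 : ℝ) + θ| < Ψ pq.2 }.Infinite }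

/-- Hausdorff measure with gauge (dimension function) `f`. -/
def hausdorffGauge {X : Type*} [EMetricSpace X] [MeasurableSpace X] [BorelSpace X]
    (f : ℝ → ℝ) : Measure X :=
  Measure.mkMetric fun r => ENNReal.ofReal (f r.toReal)

/-- Second partial derivative `∂²g_u/∂x_i∂x_j (x)`. -/
def secondPartial {m l : ℕ} (g : (Fin m → ℝ) → (Fin l → ℝ)) (u : Fin l)
    (x : Fin m → ℝ) (i j : Fin m) : ℝ :=
  iteratedFDeriv ℝ 2 (fun y => g y u) x ![Pi.single i 1, Pi.single j 1]

/-- The matrix `Λ(g,s,x)` with `(j,i)` entry `∑_u s_u ∂²g_u/∂x_i∂x_j (x)`. -/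
def Lambda {m l : ℕ} (g : (Fin m → ℝ) → (Fin l → ℝ)) (s : Fin l → ℝ)
    (x : Fin m → ℝ) : Matrix (Fin m) (Fin m) ℝ :=
  Matrix.of fun j i => ∑ u, s u * secondPartial g u x i j

/-- The point `(x, z) ∈ ℝⁿ` built from `x ∈ ℝ^{n-l}` and `z ∈ ℝ^l`. -/
def graphMap {n l : ℕ} (x : Fin (n - l) → ℝ) (z : Fin l → ℝ) : Fin n → ℝ :=
  fun i => if h : (i : ℕ) < n - l then x ⟨i, h⟩
    else if h2 : (i : ℕ) - (n - l) < l then z ⟨(i : ℕ) - (n - l), h2⟩ else 0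


/-- Outer measures dominated by the gauge on small sets. -/
def GBdd {X : Type*} [PseudoMetricSpace X] (f : ℝ → ℝ) (D : ℝ) (μ : OuterMeasure X) : Prop :=
  ∀ (s : Set X) (d : ℝ), 0 ≤ d → d ≤ D → (∀ x ∈ s, ∀ y ∈ s, dist x y ≤ d) →
    μ s ≤ ENNReal.ofReal (f d)

lemma gauge_le {X : Type*} [MetricSpace X] [MeasurableSpace X] [BorelSpace X]
    (f : ℝ → ℝ) (D : ℝ) (hD : 0 < D) (μ : OuterMeasure X) (h : GBdd f D μ) (A : Set X) :
    μ A ≤ hausdorffGauge f A := by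
  have h1 : μ ≤ OuterMeasure.mkMetric (fun r => ENNReal.ofReal (f r.toReal)) := by
    refine OuterMeasure.le_mkMetric _ μ (ENNReal.ofReal D) (by simpa using hD) ?_
    intro s hs
    have hfin : Metric.ediam s ≠ ⊤ := ne_top_of_le_ne_top ENNReal.ofReal_ne_top hs
    refine h s _ ENNReal.toReal_nonneg ?_ ?_
    · exact ENNReal.toReal_le_of_le_ofReal hD.le hs
    · intro x hx y hy
      rw [dist_edist]
      exact ENNReal.toReal_mono hfin (Metric.edist_le_ediam_of_mem hx hy)
  refine (h1 A).trans ?_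
  unfold hausdorffGauge
  rw [← Measure.coe_toOuterMeasure, Measure.mkMetric_toOuterMeasure]

lemma gauge_null {X : Type*} [MetricSpace X] [MeasurableSpace X] [BorelSpace X]
    (f : ℝ → ℝ) (hfmono : MonotoneOn f (Set.Ici 0)) (A : Set X)
    (h : ∀ D : ℝ, 0 < D → ∀ μ : OuterMeasure X, GBdd f D μ → μ A = 0) :
    hausdorffGauge f A = 0 := by
  unfold hausdorffGauge
  rw [← Measure.coe_toOuterMeasure, Measure.mkMetric_toOuterMeasure]
  unfold OuterMeasure.mkMetric OuterMeasure.mkMetric'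
  simp only [OuterMeasure.iSup_apply, ENNReal.iSup_eq_zero]
  intro r hr
  obtain ⟨D, hD0, hDr⟩ : ∃ D : ℝ, 0 < D ∧ ENNReal.ofReal D ≤ r := by
    obtain ⟨D, h1, h2⟩ := ENNReal.lt_iff_exists_nnreal_btwn.1 hr
    exact ⟨D, by simpa using h1, by simpa using h2.le⟩
  refine h D hD0 _ ?_
  intro s d hd0 hdD hs
  have he : Metric.ediam s ≤ ENNReal.ofReal d := by
    refine Metric.ediam_le fun x hx y hy => ?_
    rw [edist_dist]
    exact ENNReal.ofReal_le_ofReal (hs x hx y hy)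
  refine (OuterMeasure.mkMetric'.pre_le
    (he.trans ((ENNReal.ofReal_le_ofReal hdD).trans hDr))).trans ?_
  refine ENNReal.ofReal_le_ofReal (hfmono ENNReal.toReal_nonneg hd0 ?_)
  exact ENNReal.toReal_le_of_le_ofReal hd0 he

lemma gauge_lipschitz {X Y : Type*} [MetricSpace X] [MeasurableSpace X] [BorelSpace X]
    [MetricSpace Y] [MeasurableSpace Y] [BorelSpace Y]
    (f : ℝ → ℝ) (hfmono : MonotoneOn f (Set.Ici 0)) (hf0 : f 0 = 0)
    (s C : ℝ) (hC : 0 < C)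
    (hI : ∀ x y : ℝ, 0 < y → y < 1 → 1 < x → f (x * y) ≤ C * x ^ s * f y)
    (φ : X → Y) (A : Set X) (K : ℝ) (hK : 1 < K)
    (hφ : ∀ x ∈ A, ∀ y ∈ A, dist (φ x) (φ y) ≤ K * dist x y)
    (hA : hausdorffGauge f A = 0) : hausdorffGauge f (φ '' A) = 0 := by
  refine gauge_null f hfmono _ fun D hD μ hμ => ?_
  set c : ℝ := C * K ^ s with hc
  have hc0 : 0 < c := by positivity
  let ν : OuterMeasure X := (ENNReal.ofReal c)⁻¹ •
    OuterMeasure.restrict A (OuterMeasure.comap φ μ)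
  have hν : GBdd f (min (1/2) (D / K)) ν := by
    intro t d hd0 hdD ht
    have h1 : d ≤ 1/2 := hdD.trans (min_le_left _ _)
    have h2 : K * d ≤ D := by
      have := hdD.trans (min_le_right _ _)
      rw [le_div_iff₀ (by linarith)] at this
      linarith
    have h3 : μ (φ '' (t ∩ A)) ≤ ENNReal.ofReal (f (K * d)) := by
      refine hμ _ _ (by positivity) h2 ?_
      rintro _ ⟨x, hx, rfl⟩ _ ⟨y, hy, rfl⟩
      refine (hφ x hx.2 y hy.2).trans ?_
      have := ht x hx.1 y hy.1
      gcongr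
    have h4 : f (K * d) ≤ c * f d := by
      rcases hd0.eq_or_lt with h | h
      · simp [← h, hf0]
      · exact hI K d h (by linarith) hK
    have h5 : ν t = (ENNReal.ofReal c)⁻¹ * μ (φ '' (t ∩ A)) := by
      simp [ν, OuterMeasure.restrict_apply, OuterMeasure.comap_apply]
    rw [h5, ← ENNReal.div_eq_inv_mul]
    refine ENNReal.div_le_of_le_mul ?_
    refine h3.trans ?_
    rw [← ENNReal.ofReal_mul' hc0.le, mul_comm (f d)]
    exact ENNReal.ofReal_le_ofReal h4
  have h6 : ν A = 0 := by
    have := gauge_le f _ (by positivity) ν hν A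
    rw [hA] at this
    simpa using this
  have h7 : ν A = (ENNReal.ofReal c)⁻¹ * μ (φ '' A) := by
    simp [ν, OuterMeasure.restrict_apply, OuterMeasure.comap_apply]
  rw [h7] at h6
  rcases mul_eq_zero.1 h6 with h | h
  · simp at h
  · exact h

lemma label_bound {X ι : Type*} [PseudoMetricSpace X] (f : ℝ → ℝ) (D : ℝ)
    (μ : OuterMeasure X) (hμ : GBdd f D μ) (T : Set X) (φ : X → ι) (Λ : Finset ι)
    (hφ : ∀ x ∈ T, φ x ∈ Λ) (d : ℝ) (hd0 : 0 ≤ d) (hdD : d ≤ D)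
    (h : ∀ x ∈ T, ∀ y ∈ T, φ x = φ y → dist x y ≤ d) :
    μ T ≤ (Λ.card : ENNReal) * ENNReal.ofReal (f d) := by
  have hsub : T ⊆ ⋃ i ∈ Λ, (T ∩ φ ⁻¹' {i}) := by
    intro x hx
    simp only [Set.mem_iUnion]
    exact ⟨φ x, hφ x hx, hx, rfl⟩
  refine (measure_mono hsub).trans ((measure_biUnion_finset_le Λ _).trans ?_)
  rw [← nsmul_eq_mul]
  refine Finset.sum_le_card_nsmul _ _ _ fun i _ => ?_
  refine hμ _ d hd0 hdD ?_
  rintro x ⟨hx, hxi⟩ y ⟨hy, hyi⟩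
  exact h x hx y hy (by rw [show φ x = i from hxi, show φ y = i from hyi])

lemma card_floor (c R : ℝ) (hR : 0 ≤ R) :
    ((Finset.Icc ⌊c - R⌋ ⌊c + R⌋).card : ℝ) ≤ 2 * R + 2 := by
  have h1 : ⌊c - R⌋ ≤ ⌊c + R⌋ := Int.floor_le_floor (by linarith)
  rw [Int.card_Icc]
  have h2 : (((⌊c + R⌋ + 1 - ⌊c - R⌋).toNat : ℤ) : ℝ) = ((⌊c + R⌋ + 1 - ⌊c - R⌋ : ℤ) : ℝ) := by
    rw [Int.toNat_of_nonneg (by omega)]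
  rw [← Int.cast_natCast, h2]
  push_cast
  have := Int.floor_le (c + R)
  have := Int.lt_floor_add_one (c - R)
  linarith

lemma mem_floor (c R x : ℝ) (h : |x - c| ≤ R) : ⌊x⌋ ∈ Finset.Icc ⌊c - R⌋ ⌊c + R⌋ := by
  rw [abs_le] at h
  rw [Finset.mem_Icc]
  exact ⟨Int.floor_le_floor (by linarith), Int.floor_le_floor (by linarith)⟩

lemma floor_eq_close {x y ρ : ℝ} (hρ : 0 < ρ) (h : ⌊x / ρ⌋ = ⌊y / ρ⌋) : |x - y| ≤ ρ := by
  have := Int.abs_sub_lt_one_of_floor_eq_floor h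
  rw [← sub_div, abs_div, abs_of_pos hρ, div_lt_one hρ] at this
  exact this.le

set_option maxHeartbeats 1000000 in
/-- One shell of the cover. -/
lemma shell_bound (m : ℕ) (A L R : ℝ) (hA : 0 < A) (hL : 0 < L) (hR : 0 < R) :
    ∃ K : ℝ, 0 < K ∧ ∀ (i : Fin m) (f : ℝ → ℝ) (D : ℝ) (μ : OuterMeasure (Fin m → ℝ))
      (_ : GBdd f D μ) (B : Set (Fin m → ℝ)) (G : (Fin m → ℝ) → ℝ)
      (G' : (Fin m → ℝ) → ((Fin m → ℝ) →L[ℝ] ℝ))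
      (_ : ∀ x ∈ B, ‖G' x‖ ≤ A)
      (_ : ∀ x ∈ B, ∀ y ∈ B, |G y - G x - G' x (y - x)| ≤ L * ‖y - x‖ ^ 2)
      (_ : ∀ x ∈ B, ∀ y ∈ B, ‖x - y‖ ≤ R * max ‖G' x‖ ‖G' y‖)
      (Q ψ θ t δ : ℝ) (_ : 1 ≤ Q) (_ : 0 < ψ) (_ : ψ ≤ 1 / 2) (_ : δ = ψ / Q)
      (_ : 0 < t) (_ : t ≤ 1) (_ : δ ≤ t ^ 2) (_ : 0 ≤ f ((8 * m / A + 4 * m + 2 + 2 * R * A) * (δ / t)))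
      (_ : (8 * m / A + 4 * m + 2 + 2 * R * A) * (δ / t) ≤ D),
      μ {x | x ∈ B ∧ (∃ p : ℤ, |Q * G x + p + θ| < ψ) ∧ A * t / 2 ≤ ‖G' x‖ ∧ ‖G' x‖ ≤ A * t ∧
        ‖G' x‖ ≤ m * |G' x (Pi.single i 1)|} ≤
      ENNReal.ofReal (K * (Q * (t ^ 2 / δ) ^ (m - 1) *
        f ((8 * m / A + 4 * m + 2 + 2 * R * A) * (δ / t)))) := by
  set P : ℝ := A * (R * A) + L * (R * A) ^ 2 with hP
  have hP0 : 0 < P := by positivity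
  refine ⟨(8 * m * L * R + 2) ^ m * (2 * R * A + 2) ^ (m - 1) * (2 * P + 4), by positivity, ?_⟩
  intro i f D μ hμ B G G' hbA hTay hbR Q ψ θ t δ hQ hψ hψ2 hδ ht ht1 hδt hfd hdD
  have hm : (1 : ℝ) ≤ m := by exact_mod_cast i.pos
  have hQ0 : 0 < Q := by linarith
  have hδ0 : 0 < δ := by rw [hδ]; positivity
  set C0 : ℝ := 8 * m / A + 4 * m + 2 + 2 * R * A with hC0
  set T : Set (Fin m → ℝ) := {x | x ∈ B ∧ (∃ p : ℤ, |Q * G x + p + θ| < ψ) ∧ A * t / 2 ≤ ‖G' x‖ ∧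
    ‖G' x‖ ≤ A * t ∧ ‖G' x‖ ≤ m * |G' x (Pi.single i 1)|} with hT
  rcases T.eq_empty_or_nonempty with he | ⟨x1, hx1⟩
  · rw [he]; simp
  have hp : ∀ x ∈ T, ∃ p : ℤ, |Q * G x + p + θ| < ψ := fun x hx => hx.2.1
  choose! p hp using hp
  set ρ : ℝ := δ / t with hρ
  have hρ0 : 0 < ρ := by positivity
  set η : ℝ := A * t / (4 * m * L) with hη
  have hη0 : 0 < η := by positivity
  let φ : (Fin m → ℝ) → (Fin m → ℤ) × ({j : Fin m // j ≠ i} → ℤ) × ℤ := fun x =>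
    (fun j => ⌊x j / η⌋, fun j => ⌊x j.1 / ρ⌋, p x)
  let Λ : Finset ((Fin m → ℤ) × ({j : Fin m // j ≠ i} → ℤ) × ℤ) :=
    (Fintype.piFinset fun j => Finset.Icc ⌊x1 j / η - 4 * m * L * R⌋ ⌊x1 j / η + 4 * m * L * R⌋) ×ˢ
    ((Fintype.piFinset fun j : {j : Fin m // j ≠ i} =>
      Finset.Icc ⌊x1 j.1 / ρ - R * A * (t ^ 2 / δ)⌋ ⌊x1 j.1 / ρ + R * A * (t ^ 2 / δ)⌋) ×ˢ
    (Finset.Icc ⌊(p x1 : ℝ) - (Q * P + 1)⌋ ⌊(p x1 : ℝ) + (Q * P + 1)⌋))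
  have hdist : ∀ x ∈ T, ‖x - x1‖ ≤ R * A * t := by
    intro x hx
    refine (hbR x hx.1 x1 hx1.1).trans ?_
    have : max ‖G' x‖ ‖G' x1‖ ≤ A * t := max_le hx.2.2.2.1 hx1.2.2.2.1
    calc R * max ‖G' x‖ ‖G' x1‖ ≤ R * (A * t) := by gcongr
      _ = _ := by ring
  have hφΛ : ∀ x ∈ T, φ x ∈ Λ := by
    intro x hx
    have hd := hdist x hx
    have hdj : ∀ j, |x j - x1 j| ≤ R * A * t := fun j => by
      have := norm_le_pi_norm (x - x1) j
      simp only [Pi.sub_apply, Real.norm_eq_abs] at this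
      exact this.trans hd
    simp only [Λ, φ, Finset.mem_product, Fintype.mem_piFinset]
    refine ⟨fun j => mem_floor _ _ _ ?_, fun j => mem_floor _ _ _ ?_, ?_⟩
    · rw [← sub_div, abs_div, abs_of_pos hη0, div_le_iff₀ hη0]
      refine (hdj j).trans (le_of_eq ?_)
      rw [hη]; field_simp
    · rw [← sub_div, abs_div, abs_of_pos hρ0, div_le_iff₀ hρ0]
      refine (hdj j).trans (le_of_eq ?_)
      rw [hρ]; field_simp
    · have hpp : |((p x : ℤ) : ℝ) - p x1| ≤ Q * P + 1 := by
        have h1 := hp x hx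
        have h2 := hp x1 hx1
        have h3 := hTay x1 hx1.1 x hx.1
        have h4 : |G' x1 (x - x1)| ≤ A * ‖x - x1‖ := by
          refine ((G' x1).le_opNorm _).trans ?_
          have := hbA x1 hx1.1
          gcongr
        have h5 : ‖x - x1‖ ≤ R * A := by
          refine hd.trans ?_
          have : R * A * t ≤ R * A * 1 := by gcongr
          linarith
        have h6 : |G x - G x1| ≤ P := by
          have h7 : A * ‖x - x1‖ ≤ A * (R * A) := by gcongr
          have h8 : L * ‖x - x1‖ ^ 2 ≤ L * (R * A) ^ 2 := by gcongr
          have h9 : |G x - G x1| ≤ |G x - G x1 - G' x1 (x - x1)| + |G' x1 (x - x1)| := by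
            have := abs_add_le (G x - G x1 - G' x1 (x - x1)) (G' x1 (x - x1))
            simpa using this
          linarith
        have h10 : |Q * (G x - G x1)| ≤ Q * P := by
          rw [abs_mul, abs_of_pos hQ0]; gcongr
        rw [abs_lt] at h1 h2
        rw [mul_sub, abs_le] at h10
        rw [abs_le]
        constructor <;> linarith [h10.1, h10.2, h1.1, h1.2, h2.1, h2.2]
      have := mem_floor _ _ _ hpp
      simpa using this
  have hdiam : ∀ x ∈ T, ∀ y ∈ T, φ x = φ y → dist x y ≤ C0 * ρ := by
    intro x hx y hy hxy
    simp only [φ, Prod.mk.injEq, funext_iff] at hxy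
    obtain ⟨hz, hw, hpe⟩ := hxy
    set h : Fin m → ℝ := y - x with hh
    have hzj : ‖h‖ ≤ η := by
      refine (pi_norm_le_iff_of_nonneg hη0.le).2 fun j => ?_
      rw [Real.norm_eq_abs]
      exact floor_eq_close hη0 (hz j).symm
    have hwj : ∀ j, j ≠ i → |h j| ≤ ρ := fun j hj =>
      floor_eq_close hρ0 (hw ⟨j, hj⟩).symm
    set h' : Fin m → ℝ := h - Pi.single i (h i) with hh'
    have hh'n : ‖h'‖ ≤ ρ := by
      refine (pi_norm_le_iff_of_nonneg hρ0.le).2 fun j => ?_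
      rw [Real.norm_eq_abs]
      by_cases hj : j = i
      · subst hj; simp [hh', hρ0.le]
      · simpa [hh', hj] using hwj j hj
    have hnh : ‖h‖ ≤ ρ + |h i| := by
      refine (pi_norm_le_iff_of_nonneg (by positivity)).2 fun j => ?_
      rw [Real.norm_eq_abs]
      by_cases hj : j = i
      · subst hj; linarith
      · have := hwj j hj
        have := abs_nonneg (h i)
        linarith
    have hsplit : G' x h = h i * G' x (Pi.single i 1) + G' x h' := by
      have : h = h i • (Pi.single i 1 : Fin m → ℝ) + h' := by
        rw [hh', ← Pi.single_smul]; simp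
      conv_lhs => rw [this]
      rw [map_add, map_smul, smul_eq_mul]
    have hGh' : |G' x h'| ≤ A * t * ρ := by
      refine ((G' x).le_opNorm _).trans ?_
      have := hx.2.2.2.1
      gcongr
    have hT1 := hTay x hx.1 y hy.1
    have hGd : |G y - G x| ≤ 2 * δ := by
      have h1 := hp x hx
      have h2 := hp y hy
      rw [hpe] at h1
      have h3 : |Q * (G y - G x)| ≤ 2 * ψ := by
        rw [abs_lt] at h1 h2
        rw [mul_sub, abs_le]; constructor <;> linarith [h1.1, h1.2, h2.1, h2.2]
      rw [abs_mul, abs_of_pos hQ0] at h3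
      rw [hδ]
      have : |G y - G x| ≤ 2 * ψ / Q := by rw [le_div_iff₀ hQ0]; linarith
      linarith [this, mul_div_assoc 2 ψ Q]
    have hquad : L * ‖h‖ ^ 2 ≤ A * t / (4 * m) * (ρ + |h i|) := by
      have : L * ‖h‖ ^ 2 ≤ L * (η * (ρ + |h i|)) := by
        rw [pow_two]; gcongr
      refine this.trans (le_of_eq ?_)
      rw [hη]; field_simp
    have hdi : A * t / (2 * m) ≤ |G' x (Pi.single i 1)| := by
      have h1 := hx.2.2.1
      have h2 := hx.2.2.2.2
      rw [div_le_iff₀ (by positivity)]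
      linarith
    have hmain : |h i| * |G' x (Pi.single i 1)| ≤
        2 * δ + A * t * ρ + A * t / (4 * m) * (ρ + |h i|) := by
      rw [← abs_mul]
      have h1 : h i * G' x (Pi.single i 1) =
        (G y - G x) - (G y - G x - G' x h) - G' x h' := by rw [hsplit]; ring
      rw [h1]
      have h2 := abs_sub ((G y - G x) - (G y - G x - G' x h)) (G' x h')
      have h3 := abs_sub (G y - G x) (G y - G x - G' x h)
      linarith
    have hkey : |h i| * (A * t / (4 * m)) ≤ 2 * δ + A * t * ρ + A * t / (4 * m) * ρ := by
      have h1 : |h i| * (A * t / (2 * m)) ≤ |h i| * |G' x (Pi.single i 1)| := by gcongr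
      have h2 : A * t / (2 * m) = 2 * (A * t / (4 * m)) := by field_simp; norm_num
      rw [h2] at h1
      have h3 := h1.trans hmain
      rw [mul_add] at h3
      linarith [mul_comm (|h i|) (A * t / (4 * m))]
    have hδρ : δ = t * ρ := by rw [hρ]; field_simp
    have hhi : |h i| ≤ (8 * m / A + 4 * m + 1) * ρ := by
      rw [← le_div_iff₀ (by positivity)] at hkey
      refine hkey.trans (le_of_eq ?_)
      rw [hδρ]; field_simp; ring
    have hC0a : (8 * m / A + 4 * m + 1) ≤ C0 := by
      have : 0 < R * A := by positivity
      rw [hC0]; linarith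
    have hC0b : 1 ≤ C0 := by
      have : 0 ≤ 8 * m / A + 4 * m := by positivity
      linarith
    rw [dist_comm, dist_eq_norm]
    refine (pi_norm_le_iff_of_nonneg (by positivity)).2 fun j => ?_
    rw [Real.norm_eq_abs]
    by_cases hj : j = i
    · subst hj
      exact hhi.trans (by gcongr)
    · refine (hwj j hj).trans ?_
      exact le_mul_of_one_le_left hρ0.le hC0b
  have hC00 : 0 ≤ C0 := by positivity
  have hfin := label_bound f D μ hμ T φ Λ hφΛ (C0 * ρ) (by positivity) hdD hdiam
  refine hfin.trans ?_
  rw [← ENNReal.ofReal_natCast, ← ENNReal.ofReal_mul (by positivity)]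
  refine ENNReal.ofReal_le_ofReal ?_
  rw [← mul_assoc, ← mul_assoc]
  refine mul_le_mul_of_nonneg_right ?_ hfd
  have hr1 : 1 ≤ t ^ 2 / δ := by rw [le_div_iff₀ hδ0]; linarith
  have hc1 : ((Fintype.piFinset fun j => Finset.Icc ⌊x1 j / η - 4 * m * L * R⌋
      ⌊x1 j / η + 4 * m * L * R⌋).card : ℝ) ≤ (8 * m * L * R + 2) ^ m := by
    rw [Fintype.card_piFinset]
    push_cast
    refine (Finset.prod_le_prod (fun _ _ => by positivity)
      (fun j _ => card_floor (x1 j / η) (4 * m * L * R) (by positivity))).trans (le_of_eq ?_)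
    simp only [Finset.prod_const, Finset.card_univ, Fintype.card_fin]
    ring
  have hc2 : ((Fintype.piFinset fun j : {j : Fin m // j ≠ i} =>
      Finset.Icc ⌊x1 j.1 / ρ - R * A * (t ^ 2 / δ)⌋ ⌊x1 j.1 / ρ + R * A * (t ^ 2 / δ)⌋).card : ℝ)
      ≤ (2 * R * A + 2) ^ (m - 1) * (t ^ 2 / δ) ^ (m - 1) := by
    rw [Fintype.card_piFinset]
    push_cast
    refine (Finset.prod_le_prod (fun _ _ => by positivity)
      (fun j _ => card_floor (x1 j.1 / ρ) (R * A * (t ^ 2 / δ)) (by positivity))).trans ?_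
    simp only [Finset.prod_const, Finset.card_univ]
    rw [show Fintype.card {j : Fin m // j ≠ i} = m - 1 by simp, ← mul_pow]
    gcongr
    rw [add_mul]
    linarith
  have hc3 : ((Finset.Icc ⌊(p x1 : ℝ) - (Q * P + 1)⌋ ⌊(p x1 : ℝ) + (Q * P + 1)⌋).card : ℝ)
      ≤ (2 * P + 4) * Q := by
    refine (card_floor _ _ (by positivity)).trans ?_
    rw [add_mul]
    linarith
  simp only [Λ, Finset.card_product]
  push_cast
  calc _ ≤ (8 * m * L * R + 2) ^ m * (((2 * R * A + 2) ^ (m - 1) * (t ^ 2 / δ) ^ (m - 1)) *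
        ((2 * P + 4) * Q)) := by gcongr
    _ = _ := by ring

lemma gamma_pow (k m : ℕ) (hm : 1 ≤ m) (s : ℝ) :
    ((2 : ℝ) ^ k) ^ s * (1 / 4 ^ k) ^ (m - 1) = ((2 : ℝ) ^ (s - 2 * ((m : ℝ) - 1))) ^ k := by
  have h1 : (2 : ℝ) ^ (2 * ((m : ℝ) - 1)) = 4 ^ (m - 1) := by
    rw [Real.rpow_mul (by norm_num), ← Real.rpow_natCast _ (m - 1), Nat.cast_sub hm]
    norm_num
  rw [Real.rpow_sub (by norm_num), h1, ← Real.rpow_pow_comm (by norm_num), div_pow, div_pow,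
    one_pow, ← pow_mul, ← pow_mul, mul_comm k (m - 1)]
  ring

lemma exists_big_coord (m : ℕ) (hm : 1 ≤ m) (T : (Fin m → ℝ) →L[ℝ] ℝ) :
    ∃ i : Fin m, ‖T‖ ≤ m * |T (Pi.single i 1)| := by
  have : Nonempty (Fin m) := ⟨⟨0, hm⟩⟩
  obtain ⟨i, hi⟩ := Finite.exists_max (fun i : Fin m => |T (Pi.single i 1)|)
  refine ⟨i, T.opNorm_le_bound (by positivity) fun x => ?_⟩
  have hx : T x = ∑ j, x j * T (Pi.single j 1) := by
    conv_lhs => rw [← Finset.univ_sum_single x]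
    rw [map_sum]
    refine Finset.sum_congr rfl fun j _ => ?_
    have : (Pi.single j (x j) : Fin m → ℝ) = x j • (Pi.single j 1 : Fin m → ℝ) := by
      rw [← Pi.single_smul]; simp
    rw [this, map_smul, smul_eq_mul]
  rw [hx, Real.norm_eq_abs]
  refine (Finset.abs_sum_le_sum_abs _ _).trans ?_
  have : ∀ j ∈ Finset.univ, |x j * T (Pi.single j 1)| ≤ ‖x‖ * |T (Pi.single i 1)| := by
    intro j _
    rw [abs_mul]
    have h1 := norm_le_pi_norm x j
    rw [Real.norm_eq_abs] at h1
    have h2 := hi j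
    gcongr
  refine (Finset.sum_le_card_nsmul _ _ _ this).trans (le_of_eq ?_)
  simp; ring

set_option maxHeartbeats 1000000 in
lemma cover_bound (m : ℕ) (hm : 1 ≤ m) (A L R C s : ℝ) (hA : 0 < A) (hL : 0 < L) (hR : 0 < R)
    (hC : 0 < C) (hs : s < 2 * ((m : ℝ) - 1)) :
    ∃ K C0 : ℝ, 0 < K ∧ 0 < C0 ∧ ∀ (f : ℝ → ℝ) (D : ℝ) (μ : OuterMeasure (Fin m → ℝ))
      (_ : MonotoneOn f (Set.Ici 0)) (_ : ∀ r : ℝ, 0 ≤ r → 0 ≤ f r)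
      (_ : ∀ x y : ℝ, 0 < y → y < 1 → 1 < x → f (x * y) ≤ C * x ^ s * f y)
      (_ : 0 < D) (_ : GBdd f D μ) (B : Set (Fin m → ℝ)) (G : (Fin m → ℝ) → ℝ)
      (G' : (Fin m → ℝ) → ((Fin m → ℝ) →L[ℝ] ℝ))
      (_ : ∀ x ∈ B, ‖G' x‖ ≤ A)
      (_ : ∀ x ∈ B, ∀ y ∈ B, |G y - G x - G' x (y - x)| ≤ L * ‖y - x‖ ^ 2)
      (_ : ∀ x ∈ B, ∀ y ∈ B, ‖x - y‖ ≤ R * max ‖G' x‖ ‖G' y‖)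
      (Q ψ θ δ : ℝ) (_ : 1 ≤ Q) (_ : 0 < ψ) (_ : ψ ≤ 1 / 2) (_ : δ = ψ / Q)
      (_ : C0 ^ 2 * δ ≤ D ^ 2),
      μ {x | x ∈ B ∧ (∃ p : ℤ, |Q * G x + p + θ| < ψ)} ≤
      ENNReal.ofReal (K * (Q * (1 / δ) ^ (m - 1) * f δ)) := by
  obtain ⟨K1, hK1, hshell⟩ := shell_bound m A L R hA hL hR
  have hm1 : (1 : ℝ) ≤ m := by exact_mod_cast hm
  set C0 : ℝ := 8 * m / A + 4 * m + 2 + 2 * R * A with hC0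
  have hC01 : 1 < C0 := by
    have : 0 ≤ 8 * m / A + 4 * m := by positivity
    have : 0 < 2 * R * A := by positivity
    rw [hC0]; linarith
  have hC00 : 0 < C0 := by linarith
  set γ : ℝ := (2 : ℝ) ^ (s - 2 * ((m : ℝ) - 1)) with hγ
  have hγ0 : 0 < γ := by positivity
  have hγ1 : γ < 1 := Real.rpow_lt_one_of_one_lt_of_neg (by norm_num) (by linarith)
  set c : ℝ := C * C0 ^ s with hc
  have hc0 : 0 < c := by positivity
  have h1γ : 0 < 1 - γ := by linarith
  refine ⟨m * (K1 * c) * (1 - γ)⁻¹ + c, C0, by positivity, hC00, ?_⟩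
  intro f D μ hfmono hfpos hI hD hμ B G G' hbA hTay hbR Q ψ θ δ hQ hψ hψ2 hδ hδD
  have hQ0 : 0 < Q := by linarith
  have hδ0 : 0 < δ := by rw [hδ]; positivity
  have hδ1 : δ < 1 := by rw [hδ, div_lt_one hQ0]; linarith
  obtain ⟨N, hN1, hN2⟩ : ∃ N : ℕ, (4 : ℝ) ^ N ≤ 1 / δ ∧ 1 / δ < (4 : ℝ) ^ (N + 1) := by
    refine exists_nat_pow_near ?_ (by norm_num)
    rw [le_div_iff₀ hδ0]; linarith
  have hfδ : 0 ≤ f δ := hfpos _ hδ0.le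
  have h4 : ∀ k : ℕ, (4 : ℝ) ^ k = 2 ^ k * 2 ^ k := fun k => by rw [← mul_pow]; norm_num
  -- scale bound
  have hscale : ∀ k ≤ N, C0 * (2 ^ k * δ) ≤ D := by
    intro k hk
    have h1 : (4 : ℝ) ^ k ≤ 1 / δ := (pow_le_pow_right₀ (by norm_num) hk).trans hN1
    rw [le_div_iff₀ hδ0] at h1
    refine le_of_sq_le_sq ?_ hD.le
    calc (C0 * (2 ^ k * δ)) ^ 2 = C0 ^ 2 * δ * (4 ^ k * δ) := by rw [h4]; ring
      _ ≤ C0 ^ 2 * δ * 1 := by gcongr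
      _ ≤ D ^ 2 := by linarith
  have hfscale : ∀ k : ℕ, f (C0 * (2 ^ k * δ)) ≤ c * ((2 : ℝ) ^ k) ^ s * f δ := by
    intro k
    have h2k : (1 : ℝ) ≤ 2 ^ k := one_le_pow₀ (by norm_num)
    have h1 : 1 < C0 * 2 ^ k := by nlinarith
    have h2 := hI (C0 * 2 ^ k) δ hδ0 hδ1 h1
    rw [Real.mul_rpow hC00.le (by positivity)] at h2
    rw [← mul_assoc, hc]
    refine h2.trans (le_of_eq (by ring))
  let T : ℕ → Fin m → Set (Fin m → ℝ) := fun k i =>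
    {x | x ∈ B ∧ (∃ p : ℤ, |Q * G x + p + θ| < ψ) ∧ A * (1 / 2) ^ k / 2 ≤ ‖G' x‖ ∧
      ‖G' x‖ ≤ A * (1 / 2) ^ k ∧ ‖G' x‖ ≤ m * |G' x (Pi.single i 1)|}
  let T0 : Set (Fin m → ℝ) := {x | x ∈ B ∧ ‖G' x‖ ≤ A * (1 / 2) ^ (N + 1)}
  set W : ℝ := Q * (1 / δ) ^ (m - 1) * f δ with hW
  have hW0 : 0 ≤ W := by positivity
  have hTk : ∀ k ≤ N, ∀ i, μ (T k i) ≤ ENNReal.ofReal (K1 * c * γ ^ k * W) := by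
    intro k hk i
    have h1 : (4 : ℝ) ^ k ≤ 1 / δ := (pow_le_pow_right₀ (by norm_num) hk).trans hN1
    have hdt : δ / (1 / 2) ^ k = 2 ^ k * δ := by
      rw [one_div, inv_pow, div_inv_eq_mul]; ring
    have htt : (((1 : ℝ) / 2) ^ k) ^ 2 = 1 / 4 ^ k := by
      rw [h4, one_div, inv_pow, inv_pow, pow_two, one_div]
    have h2 := hshell i f D μ hμ B G G' hbA hTay hbR Q ψ θ ((1 / 2) ^ k) δ hQ hψ hψ2 hδ
      (by positivity) (pow_le_one₀ (by norm_num) (by norm_num))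
      (by
        rw [htt, le_div_iff₀ (by positivity)]
        rw [le_div_iff₀ hδ0] at h1
        linarith)
      (hfpos _ (by rw [hdt]; positivity))
      (by rw [hdt]; exact hscale k hk)
    refine h2.trans (ENNReal.ofReal_le_ofReal ?_)
    rw [hdt, htt]
    have h3 := hfscale k
    have hγk : ((2 : ℝ) ^ k) ^ s * (1 / 4 ^ k) ^ (m - 1) = γ ^ k := by
      rw [hγ]; exact gamma_pow k m hm s
    calc K1 * (Q * (1 / 4 ^ k / δ) ^ (m - 1) * f (C0 * (2 ^ k * δ)))
        ≤ K1 * (Q * (1 / 4 ^ k / δ) ^ (m - 1) * (c * ((2 : ℝ) ^ k) ^ s * f δ)) := by gcongr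
      _ = K1 * c * (((2 : ℝ) ^ k) ^ s * (1 / 4 ^ k) ^ (m - 1)) * W := by
        rw [hW, div_eq_mul_one_div (1 / 4 ^ k) δ, mul_pow]; ring
      _ = _ := by rw [hγk]
  have hT0 : μ T0 ≤ ENNReal.ofReal (c * W) := by
    have h2N : (0 : ℝ) < 2 ^ N := by positivity
    have h1 : μ T0 ≤ ENNReal.ofReal (f (C0 * (2 ^ N * δ))) := by
      refine hμ _ _ (by positivity) (hscale N le_rfl) ?_
      intro x hx y hy
      rw [dist_eq_norm]
      refine (hbR x hx.1 y hy.1).trans ?_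
      have h3 : ((1 : ℝ) / 2) ^ (N + 1) ≤ 2 * (2 ^ N * δ) := by
        rw [div_lt_iff₀ hδ0, h4] at hN2
        rw [one_div, inv_pow, inv_le_iff_one_le_mul₀ (by positivity)]
        rw [pow_succ] at hN2 ⊢
        nlinarith
      calc R * max ‖G' x‖ ‖G' y‖ ≤ R * (A * (1 / 2) ^ (N + 1)) := by
            have := max_le hx.2 hy.2
            gcongr
        _ ≤ R * (A * (2 * (2 ^ N * δ))) := by gcongr
        _ = (2 * R * A) * (2 ^ N * δ) := by ring
        _ ≤ C0 * (2 ^ N * δ) := by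
            have : 2 * R * A ≤ C0 := by
              have : 0 ≤ 8 * m / A + 4 * m := by positivity
              rw [hC0]; linarith
            gcongr
    refine h1.trans (ENNReal.ofReal_le_ofReal ((hfscale N).trans ?_))
    have h5 : ((2 : ℝ) ^ N) ^ s ≤ (1 / δ) ^ (m - 1) := by
      calc ((2 : ℝ) ^ N) ^ s ≤ ((2 : ℝ) ^ N) ^ (((2 * (m - 1) : ℕ) : ℝ)) := by
            refine Real.rpow_le_rpow_of_exponent_le (one_le_pow₀ (by norm_num)) ?_
            push_cast [Nat.cast_sub hm]
            exact hs.le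
        _ = ((4 : ℝ) ^ N) ^ (m - 1) := by
            rw [Real.rpow_natCast, pow_mul, h4, pow_two]
        _ ≤ _ := by gcongr
    calc c * ((2 : ℝ) ^ N) ^ s * f δ ≤ c * (1 / δ) ^ (m - 1) * f δ := by gcongr
      _ = 1 * (c * (1 / δ) ^ (m - 1) * f δ) := by ring
      _ ≤ Q * (c * (1 / δ) ^ (m - 1) * f δ) := by gcongr
      _ = c * W := by rw [hW]; ring
  have hsub : {x | x ∈ B ∧ (∃ p : ℤ, |Q * G x + p + θ| < ψ)} ⊆
      (⋃ k ∈ Finset.range (N + 1), ⋃ i ∈ (Finset.univ : Finset (Fin m)), T k i) ∪ T0 := by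
    rintro x ⟨hxB, hxp⟩
    by_cases hx0 : ‖G' x‖ ≤ A * (1 / 2) ^ (N + 1)
    · exact Or.inr ⟨hxB, hx0⟩
    left
    push Not at hx0
    have hex : ∃ k : ℕ, A * (1 / 2) ^ (k + 1) < ‖G' x‖ := ⟨N, hx0⟩
    classical
    have hk := Nat.find_spec hex
    have hkN : Nat.find hex ≤ N := Nat.find_min' hex hx0
    have hkm : ∀ j < Nat.find hex, ‖G' x‖ ≤ A * (1 / 2) ^ (j + 1) := fun j hj =>
      not_lt.1 (Nat.find_min hex hj)
    set k := Nat.find hex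
    obtain ⟨i, hi⟩ := exists_big_coord m hm (G' x)
    simp only [Set.mem_iUnion, Finset.mem_range, Finset.mem_univ]
    refine ⟨k, by omega, i, trivial, hxB, hxp, ?_, ?_, hi⟩
    · rw [pow_succ] at hk; linarith
    · rcases Nat.eq_zero_or_pos k with h | h
      · rw [h]; simpa using hbA x hxB
      · have := hkm (k - 1) (by omega)
        rwa [Nat.sub_add_cancel h] at this
  refine (measure_mono hsub).trans ((measure_union_le _ _).trans ?_)
  have hsum : μ (⋃ k ∈ Finset.range (N + 1), ⋃ i ∈ (Finset.univ : Finset (Fin m)), T k i) ≤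
      ENNReal.ofReal (m * (K1 * c) * (1 - γ)⁻¹ * W) := by
    refine (measure_biUnion_finset_le _ _).trans ?_
    have h1 : ∀ k ∈ Finset.range (N + 1), μ (⋃ i ∈ (Finset.univ : Finset (Fin m)), T k i) ≤
        ENNReal.ofReal (m * (K1 * c * γ ^ k * W)) := by
      intro k hk
      refine (measure_biUnion_finset_le _ _).trans ?_
      refine (Finset.sum_le_card_nsmul _ _ _ fun i _ =>
        hTk k (by rw [Finset.mem_range] at hk; omega) i).trans (le_of_eq ?_)
      rw [nsmul_eq_mul, ENNReal.ofReal_mul (p := (m : ℝ)) (by positivity)]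
      simp only [Finset.card_univ, Fintype.card_fin, ENNReal.ofReal_natCast]
    refine (Finset.sum_le_sum h1).trans ?_
    rw [← ENNReal.ofReal_sum_of_nonneg (fun k _ => by positivity)]
    refine ENNReal.ofReal_le_ofReal ?_
    have h2 : ∑ k ∈ Finset.range (N + 1), γ ^ k ≤ (1 - γ)⁻¹ := by
      rw [← tsum_geometric_of_lt_one hγ0.le hγ1]
      exact (summable_geometric_of_lt_one hγ0.le hγ1).sum_le_tsum _ (fun k _ => by positivity)
    calc ∑ k ∈ Finset.range (N + 1), m * (K1 * c * γ ^ k * W)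
        = m * (K1 * c) * (∑ k ∈ Finset.range (N + 1), γ ^ k) * W := by
          rw [Finset.mul_sum, Finset.sum_mul]
          exact Finset.sum_congr rfl fun k _ => by ring
      _ ≤ _ := by gcongr
  refine (add_le_add hsum hT0).trans (le_of_eq ?_)
  rw [← ENNReal.ofReal_add (by positivity) (by positivity)]
  congr 1; ring

/-- The linear form with coefficients `b`. -/
def lform {l : ℕ} (b : Fin l → ℝ) : (Fin l → ℝ) →L[ℝ] ℝ :=
  ∑ u, b u • (ContinuousLinearMap.proj u : (Fin l → ℝ) →L[ℝ] ℝ)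

lemma lform_apply {l : ℕ} (b z : Fin l → ℝ) : lform b z = ∑ u, b u * z u := by
  simp [lform]

lemma lform_norm_le {l : ℕ} (b : Fin l → ℝ) : ‖lform b‖ ≤ l * ‖b‖ := by
  refine (lform b).opNorm_le_bound (by positivity) fun z => ?_
  rw [lform_apply, Real.norm_eq_abs]
  refine (Finset.abs_sum_le_sum_abs _ _).trans ?_
  have : ∀ u ∈ Finset.univ, |b u * z u| ≤ ‖b‖ * ‖z‖ := by
    intro u _
    rw [abs_mul]
    exact mul_le_mul (norm_le_pi_norm b u) (norm_le_pi_norm z u) (abs_nonneg _) (norm_nonneg _)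
  refine (Finset.sum_le_card_nsmul _ _ _ this).trans (le_of_eq ?_)
  simp; ring

lemma le_lform_norm {l : ℕ} (b : Fin l → ℝ) : ‖b‖ ≤ ‖lform b‖ := by
  refine (pi_norm_le_iff_of_nonneg (norm_nonneg _)).2 fun u => ?_
  have h := (lform b).le_opNorm (Pi.single u 1)
  rw [lform_apply] at h
  have h2 : ‖(Pi.single u 1 : Fin l → ℝ)‖ = 1 := by
    rw [Pi.norm_single]; simp
  rw [h2, mul_one] at h
  simpa [Pi.single_apply] using h

lemma lform_smul {l : ℕ} (c : ℝ) (b : Fin l → ℝ) : lform (c • b) = c • lform b := by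
  ext z; simp [lform_apply, Finset.mul_sum, mul_assoc]

lemma lform_continuous {l : ℕ} : Continuous (lform : (Fin l → ℝ) → ((Fin l → ℝ) →L[ℝ] ℝ)) := by
  unfold lform
  fun_prop

/-- nondegeneracy of the Hessian pairing at a point -/
lemma hess_lower {m l : ℕ} (g : (Fin m → ℝ) → (Fin l → ℝ)) (x0 : Fin m → ℝ)
    (hg : ContDiffAt ℝ 2 g x0)
    (hdet : ∀ s : Fin l → ℝ, s ≠ 0 → IsUnit (Lambda g s x0)) :
    ∃ c : ℝ, 0 < c ∧ ∀ (b : Fin l → ℝ) (v : Fin m → ℝ),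
      c * ‖b‖ * ‖v‖ ≤ ‖(lform b).comp (fderiv ℝ (fderiv ℝ g) x0 v)‖ := by
  set H := fderiv ℝ (fderiv ℝ g) x0 with hH
  have hg1 : ContDiffAt ℝ 1 (fderiv ℝ g) x0 := hg.fderiv_right (by norm_num)
  have hdg : DifferentiableAt ℝ (fderiv ℝ g) x0 := hg1.differentiableAt (by norm_num)
  have hev : ∀ᶠ y in nhds x0, DifferentiableAt ℝ g y := by
    have := hg.eventually (by simp)
    filter_upwards [this] with y hy
    exact hy.differentiableAt (by norm_num)
  have hsp : ∀ u i j, secondPartial g u x0 i j = H (Pi.single i 1) (Pi.single j 1) u := by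
    intro u i j
    unfold secondPartial
    rw [iteratedFDeriv_two_apply]
    have he : fderiv ℝ (fun y => g y u) =ᶠ[nhds x0] fun y =>
        (ContinuousLinearMap.proj u : (Fin l → ℝ) →L[ℝ] ℝ).comp (fderiv ℝ g y) := by
      filter_upwards [hev] with y hy
      have h1 := (ContinuousLinearMap.proj (R := ℝ) (φ := fun _ : Fin l => ℝ) u).hasFDerivAt.comp y
        hy.hasFDerivAt
      exact h1.fderiv
    have h2 : HasFDerivAt (fun y =>
        (ContinuousLinearMap.proj u : (Fin l → ℝ) →L[ℝ] ℝ).comp (fderiv ℝ g y))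
        ((ContinuousLinearMap.compL ℝ (Fin m → ℝ) (Fin l → ℝ) ℝ
          (ContinuousLinearMap.proj u : (Fin l → ℝ) →L[ℝ] ℝ)).comp H) x0 :=
      (ContinuousLinearMap.compL ℝ (Fin m → ℝ) (Fin l → ℝ) ℝ
          (ContinuousLinearMap.proj u : (Fin l → ℝ) →L[ℝ] ℝ)).hasFDerivAt.comp x0 hdg.hasFDerivAt
    rw [he.fderiv_eq, h2.fderiv]
    simp
  have hnz : ∀ b v, b ≠ 0 → v ≠ 0 → (lform b).comp (H v) ≠ 0 := by
    intro b v hb hv h0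
    have hmul : (Lambda g b x0).mulVec v = 0 := by
      ext j
      have h1 : (lform b).comp (H v) (Pi.single j 1) = 0 := by rw [h0]; rfl
      rw [ContinuousLinearMap.comp_apply, lform_apply] at h1
      have hv' : H v = ∑ i, v i • H (Pi.single i 1) := by
        conv_lhs => rw [← Finset.univ_sum_single v]
        rw [map_sum]
        refine Finset.sum_congr rfl fun i _ => ?_
        rw [← map_smul, ← Pi.single_smul]; simp
      rw [hv'] at h1
      rw [Pi.zero_apply, ← h1]
      simp only [Matrix.mulVec, dotProduct, Lambda, Matrix.of_apply, hsp]
      simp only [ContinuousLinearMap.sum_apply, ContinuousLinearMap.smul_apply, Finset.sum_apply,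
        Pi.smul_apply, smul_eq_mul, Finset.mul_sum, Finset.sum_mul]
      rw [Finset.sum_comm]
      refine Finset.sum_congr rfl fun _ _ => Finset.sum_congr rfl fun _ _ => by ring
    have hinj := Matrix.mulVec_injective_iff_isUnit.2 (hdet b hb)
    exact hv (hinj (by rw [hmul, Matrix.mulVec_zero]))
  have hcont : Continuous (fun bv : (Fin l → ℝ) × (Fin m → ℝ) => ‖(lform bv.1).comp (H bv.2)‖) := by
    have := (lform_continuous (l := l)).comp (continuous_fst (X := Fin l → ℝ) (Y := Fin m → ℝ))
    have h2 : Continuous fun bv : (Fin l → ℝ) × (Fin m → ℝ) => H bv.2 := by fun_prop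
    exact (this.clm_comp h2).norm
  obtain ⟨c, hc0, hc⟩ := ((isCompact_sphere (0 : Fin l → ℝ) 1).prod
    (isCompact_sphere (0 : Fin m → ℝ) 1)).exists_forall_le' hcont.continuousOn (a := 0) (by
      rintro ⟨b, v⟩ ⟨hb, hv⟩
      simp only [mem_sphere_iff_norm, sub_zero] at hb hv
      refine norm_pos_iff.2 (hnz b v ?_ ?_)
      · rintro rfl; simp at hb
      · rintro rfl; simp at hv)
  refine ⟨c, hc0, fun b v => ?_⟩
  by_cases hb : b = 0
  · simp [hb]
  by_cases hv : v = 0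
  · simp [hv]
  have hb0 : 0 < ‖b‖ := norm_pos_iff.2 hb
  have hv0 : 0 < ‖v‖ := norm_pos_iff.2 hv
  have h := hc (‖b‖⁻¹ • b, ‖v‖⁻¹ • v) ⟨by simp [norm_smul, hb0.ne'], by simp [norm_smul, hv0.ne']⟩
  simp only [lform_smul, map_smul, ContinuousLinearMap.smul_comp, ContinuousLinearMap.comp_smul,
    norm_smul, norm_inv, norm_norm] at h
  calc c * ‖b‖ * ‖v‖ ≤ (‖v‖⁻¹ * (‖b‖⁻¹ * ‖(lform b).comp (H v)‖)) * ‖b‖ * ‖v‖ := by gcongr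
    _ = _ := by field_simp

set_option maxHeartbeats 1000000 in
lemma local_aux {m l : ℕ} (g : (Fin m → ℝ) → (Fin l → ℝ)) (x0 : Fin m → ℝ)
    (F : (Fin m → ℝ) → ((Fin m → ℝ) →L[ℝ] (Fin l → ℝ)))
    (H : (Fin m → ℝ) →L[ℝ] ((Fin m → ℝ) →L[ℝ] (Fin l → ℝ))) (c r ε L0 A0 : ℝ)
    (hc0 : 0 < c) (hL00 : 0 < L0) (hA00 : 0 < A0)
    (hc : ∀ (b : Fin l → ℝ) (v : Fin m → ℝ), c * ‖b‖ * ‖v‖ ≤ ‖(lform b).comp (H v)‖)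
    (hε : ε = c / (2 * (l + 1))) (hε0 : 0 < ε)
    (hb1 : ∀ x ∈ Metric.ball x0 r, ∀ y ∈ Metric.ball x0 r,
      ‖F x - F y - H (x - y)‖ ≤ ε * ‖x - y‖)
    (hdist2 : ∀ x ∈ Metric.ball x0 r, ‖x - x0‖ ≤ 1)
    (hbd : ∀ x ∈ Metric.ball x0 r, ‖F x‖ ≤ A0)
    (hTay : ∀ x ∈ Metric.ball x0 r, ∀ y ∈ Metric.ball x0 r,
      ‖g y - g x - F x (y - x)‖ ≤ L0 * ‖y - x‖ ^ 2) :
    ∃ A L R : ℝ, 0 < A ∧ 0 < L ∧ 0 < R ∧ 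
      ∀ (a : Fin m → ℝ) (b : Fin l → ℝ), ‖a‖ ≤ 1 → ‖b‖ ≤ 1 → (‖a‖ = 1 ∨ ‖b‖ = 1) →
      ∃ G' : (Fin m → ℝ) → ((Fin m → ℝ) →L[ℝ] ℝ),
        (∀ x ∈ Metric.ball x0 r, ‖G' x‖ ≤ A) ∧
        (∀ x ∈ Metric.ball x0 r, ∀ y ∈ Metric.ball x0 r,
          |(lform a y + lform b (g y)) - (lform a x + lform b (g x)) - G' x (y - x)|
            ≤ L * ‖y - x‖ ^ 2) ∧
        (∀ x ∈ Metric.ball x0 r, ∀ y ∈ Metric.ball x0 r,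
          ‖x - y‖ ≤ R * max ‖G' x‖ ‖G' y‖) := by
  set A1 : ℝ := l * A0 + 1 with hA1
  have hA10 : 0 < A1 := by positivity
  set t : ℝ := 1 / (2 * A1) with ht
  have ht0 : 0 < t := by positivity
  refine ⟨m + A1, l * L0 + 1, 4 / (c * t) + 4, by positivity, by positivity, by positivity, ?_⟩
  intro a b ha hb hab
  have hlb : ‖lform b‖ ≤ l * ‖b‖ := lform_norm_le b
  have hcomp : ∀ x ∈ Metric.ball x0 r, ‖(lform b).comp (F x)‖ ≤ A1 * ‖b‖ := by
    intro x hx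
    refine ((lform b).opNorm_comp_le _).trans ?_
    calc ‖lform b‖ * ‖F x‖ ≤ (l * ‖b‖) * A0 := by
          have := hbd x hx
          gcongr
      _ ≤ A1 * ‖b‖ := by
          rw [hA1, add_mul]
          have := norm_nonneg b
          linarith [mul_right_comm (l : ℝ) ‖b‖ A0]
  refine ⟨fun x => lform a + (lform b).comp (F x), ?_, ?_, ?_⟩
  · intro x hx
    refine (norm_add_le _ _).trans ?_
    have h1 := lform_norm_le a
    have h2 : (m : ℝ) * ‖a‖ ≤ m * 1 := by gcongr
    have h3 := hcomp x hx
    have h4 : A1 * ‖b‖ ≤ A1 * 1 := by gcongr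
    linarith
  · intro x hx y hy
    have h1 : (lform a y + lform b (g y)) - (lform a x + lform b (g x)) -
        (lform a + (lform b).comp (F x)) (y - x) =
        lform b (g y - g x - F x (y - x)) := by
      simp only [ContinuousLinearMap.add_apply, ContinuousLinearMap.comp_apply, map_sub]
      ring
    rw [h1, ← Real.norm_eq_abs]
    refine ((lform b).le_opNorm _).trans ?_
    have h2 := hTay x hx y hy
    calc ‖lform b‖ * ‖g y - g x - F x (y - x)‖ ≤ (l * 1) * (L0 * ‖y - x‖ ^ 2) := by
          have : ‖lform b‖ ≤ l * 1 := hlb.trans (by gcongr)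
          gcongr
      _ ≤ (l * L0 + 1) * ‖y - x‖ ^ 2 := by
          have := sq_nonneg ‖y - x‖
          rw [add_mul]; linarith
  · intro x hx y hy
    set Gx := lform a + (lform b).comp (F x) with hGx
    set Gy := lform a + (lform b).comp (F y) with hGy
    have hmx : ‖Gx‖ ≤ max ‖Gx‖ ‖Gy‖ := le_max_left _ _
    have hmy : ‖Gy‖ ≤ max ‖Gx‖ ‖Gy‖ := le_max_right _ _
    set mx := max ‖Gx‖ ‖Gy‖
    have hmx0 : 0 ≤ mx := (norm_nonneg _).trans hmx
    by_cases hbt : t ≤ ‖b‖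
    · have h1 : Gx - Gy = (lform b).comp (H (x - y)) +
          (lform b).comp (F x - F y - H (x - y)) := by
        rw [hGx, hGy]
        ext z
        simp
      have h2 := hc b (x - y)
      have h3 : ‖(lform b).comp (F x - F y - H (x - y))‖ ≤
          c / 2 * ‖b‖ * ‖x - y‖ := by
        refine ((lform b).opNorm_comp_le _).trans ?_
        have h4 := hb1 x hx y hy
        calc _ ≤ (l * ‖b‖) * (ε * ‖x - y‖) := by gcongr
          _ ≤ ((l + 1) * ‖b‖) * (ε * ‖x - y‖) := by gcongr; linarith
          _ = c / 2 * ‖b‖ * ‖x - y‖ := by rw [hε]; field_simp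
      have h5 : ‖(lform b).comp (H (x - y))‖ ≤ ‖Gx - Gy‖ +
          ‖(lform b).comp (F x - F y - H (x - y))‖ := by
        rw [h1]; exact norm_le_add_norm_add _ _
      have h6 : ‖Gx - Gy‖ ≤ 2 * mx := (norm_sub_le _ _).trans (by linarith)
      have h7 : c / 2 * ‖b‖ * ‖x - y‖ ≤ 2 * mx := by linarith
      have h8 : c / 2 * t * ‖x - y‖ ≤ 2 * mx := le_trans (by gcongr) h7
      have h9 : ‖x - y‖ ≤ 4 / (c * t) * mx := by
        rw [div_mul_eq_mul_div, le_div_iff₀ (by positivity)]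
        linarith
      rw [add_mul]; linarith
    · push Not at hbt
      have ht1 : t < 1 := by
        rw [ht, div_lt_one (by positivity)]
        have : 0 ≤ l * A0 := by positivity
        linarith
      have ha1 : ‖a‖ = 1 := by
        rcases hab with h | h
        · exact h
        · linarith
      have h1 := le_lform_norm a
      have h2 := hcomp x hx
      have h3 : A1 * ‖b‖ ≤ 1 / 2 := by
        calc A1 * ‖b‖ ≤ A1 * t := by gcongr
          _ = 1 / 2 := by rw [ht]; field_simp
      have h4 : ‖lform a‖ ≤ ‖Gx‖ + ‖(lform b).comp (F x)‖ := by
        have : lform a = Gx - (lform b).comp (F x) := by rw [hGx]; simp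
        rw [this]; exact norm_sub_le _ _
      have h5 : 1 / 2 ≤ mx := by linarith
      have h6 : ‖x - y‖ ≤ 2 := by
        have := norm_sub_le_norm_sub_add_norm_sub x x0 y
        have h7 := hdist2 x hx
        have h8 := hdist2 y hy
        rw [norm_sub_rev] at h8
        linarith
      have h7 : 0 ≤ 4 / (c * t) * mx := by positivity
      rw [add_mul]; linarith

lemma strict_ball {E F : Type*} [NormedAddCommGroup E] [NormedSpace ℝ E] [NormedAddCommGroup F]
    [NormedSpace ℝ F] (k : E → F) (H : E →L[ℝ] F) (x0 : E) (h : HasStrictFDerivAt k H x0)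
    (ε : ℝ) (hε : 0 < ε) : ∃ r1 > 0, ∀ x ∈ Metric.ball x0 r1, ∀ y ∈ Metric.ball x0 r1,
      ‖k x - k y - H (x - y)‖ ≤ ε * ‖x - y‖ := by
  have hev := h.isLittleO.def hε
  rw [nhds_prod_eq] at hev
  obtain ⟨t, ht, h⟩ := Filter.mem_prod_same_iff.1 hev
  obtain ⟨r1, hr1, hsub⟩ := Metric.mem_nhds_iff.1 ht
  exact ⟨r1, hr1, fun x hx y hy => h (Set.mk_mem_prod (hsub hx) (hsub hy))⟩

lemma taylor_ball {E F : Type*} [NormedAddCommGroup E] [NormedSpace ℝ E] [NormedAddCommGroup F]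
    [NormedSpace ℝ F] (g : E → F) (k : E → (E →L[ℝ] F)) (x0 : E) (r L0 : ℝ) (hL00 : 0 < L0)
    (hd : ∀ x ∈ Metric.ball x0 r, HasFDerivAt g (k x) x)
    (hLip : ∀ x ∈ Metric.ball x0 r, ∀ y ∈ Metric.ball x0 r, ‖k x - k y‖ ≤ L0 * ‖x - y‖) :
    ∀ x ∈ Metric.ball x0 r, ∀ y ∈ Metric.ball x0 r,
      ‖g y - g x - k x (y - x)‖ ≤ L0 * ‖y - x‖ ^ 2 := by
  intro x hx y hy
  have hseg : segment ℝ x y ⊆ Metric.ball x0 r := (convex_ball x0 r).segment_subset hx hy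
  have h := Convex.norm_image_sub_le_of_norm_hasFDerivWithin_le' (f := g) (f' := k)
      (φ := k x) (C := L0 * ‖y - x‖) (s := segment ℝ x y) (x := x) (y := y)
      (fun z hz => (hd z (hseg hz)).hasFDerivWithinAt)
      (fun z hz => by
        refine (hLip z (hseg hz) x hx).trans ?_
        have : ‖z - x‖ ≤ ‖y - x‖ := norm_sub_le_of_mem_segment hz
        gcongr) (convex_segment x y) (left_mem_segment ℝ x y) (right_mem_segment ℝ x y)
  refine h.trans (le_of_eq (by ring))

set_option maxHeartbeats 1000000 in
lemma local_structure {m l : ℕ} (U : Set (Fin m → ℝ)) (hU : IsOpen U)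
    (g : (Fin m → ℝ) → (Fin l → ℝ)) (hg : ContDiffOn ℝ 2 g U) (x0 : Fin m → ℝ) (hx0 : x0 ∈ U)
    (hdet : ∀ s : Fin l → ℝ, s ≠ 0 → IsUnit (Lambda g s x0)) :
    ∃ r A L R : ℝ, 0 < r ∧ 0 < A ∧ 0 < L ∧ 0 < R ∧ Metric.ball x0 r ⊆ U ∧
      ∀ (a : Fin m → ℝ) (b : Fin l → ℝ), ‖a‖ ≤ 1 → ‖b‖ ≤ 1 → (‖a‖ = 1 ∨ ‖b‖ = 1) →
      ∃ G' : (Fin m → ℝ) → ((Fin m → ℝ) →L[ℝ] ℝ),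
        (∀ x ∈ Metric.ball x0 r, ‖G' x‖ ≤ A) ∧
        (∀ x ∈ Metric.ball x0 r, ∀ y ∈ Metric.ball x0 r,
          |(lform a y + lform b (g y)) - (lform a x + lform b (g x)) - G' x (y - x)|
            ≤ L * ‖y - x‖ ^ 2) ∧
        (∀ x ∈ Metric.ball x0 r, ∀ y ∈ Metric.ball x0 r,
          ‖x - y‖ ≤ R * max ‖G' x‖ ‖G' y‖) := by
  have hgat : ContDiffAt ℝ 2 g x0 := hg.contDiffAt (hU.mem_nhds hx0)
  obtain ⟨c, hc0, hc⟩ := hess_lower g x0 hgat hdet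
  set H := fderiv ℝ (fderiv ℝ g) x0 with hH
  have hg1 : ContDiffAt ℝ 1 (fderiv ℝ g) x0 := hgat.fderiv_right (by norm_num)
  have hstrict : HasStrictFDerivAt (fderiv ℝ g) H x0 := hg1.hasStrictFDerivAt (by norm_num)
  set ε : ℝ := c / (2 * (l + 1)) with hε
  have hε0 : 0 < ε := by positivity
  obtain ⟨r1, hr1, hb1⟩ := strict_ball (fderiv ℝ g) H x0 hstrict ε hε0
  obtain ⟨r2, hr2, hb2⟩ := Metric.isOpen_iff.1 hU x0 hx0
  set r : ℝ := min 1 (min r1 r2) with hr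
  have hr0 : 0 < r := by positivity
  have hrr1 : Metric.ball x0 r ⊆ Metric.ball x0 r1 :=
    Metric.ball_subset_ball ((min_le_right _ _).trans (min_le_left _ _))
  have hrU : Metric.ball x0 r ⊆ U :=
    (Metric.ball_subset_ball ((min_le_right _ _).trans (min_le_right _ _))).trans hb2
  have hdist2 : ∀ x ∈ Metric.ball x0 r, ‖x - x0‖ ≤ 1 := fun x hx => by
    rw [mem_ball_iff_norm] at hx
    exact hx.le.trans (min_le_left _ _)
  set L0 : ℝ := ‖H‖ + ε with hL0
  have hL00 : 0 < L0 := by positivity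
  have hLip : ∀ x ∈ Metric.ball x0 r, ∀ y ∈ Metric.ball x0 r,
      ‖fderiv ℝ g x - fderiv ℝ g y‖ ≤ L0 * ‖x - y‖ := by
    intro x hx y hy
    have h1 := hb1 x (hrr1 hx) y (hrr1 hy)
    have h2 := H.le_opNorm (x - y)
    have h3 := norm_le_norm_sub_add (fderiv ℝ g x - fderiv ℝ g y) (H (x - y))
    rw [hL0, add_mul]; linarith
  set A0 : ℝ := ‖fderiv ℝ g x0‖ + L0 with hA0
  have hA00 : 0 < A0 := by positivity
  have hbd : ∀ x ∈ Metric.ball x0 r, ‖fderiv ℝ g x‖ ≤ A0 := by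
    intro x hx
    have h1 := hLip x hx x0 (Metric.mem_ball_self hr0)
    have h2 : L0 * ‖x - x0‖ ≤ L0 * 1 := by
      have := hdist2 x hx
      gcongr
    have h3 := norm_le_norm_sub_add (fderiv ℝ g x) (fderiv ℝ g x0)
    rw [hA0]; linarith
  have hTay : ∀ x ∈ Metric.ball x0 r, ∀ y ∈ Metric.ball x0 r,
      ‖g y - g x - fderiv ℝ g x (y - x)‖ ≤ L0 * ‖y - x‖ ^ 2 := by
    exact taylor_ball g (fderiv ℝ g) x0 r L0 hL00 (fun x hx => ((hg.contDiffAt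
      (hU.mem_nhds (hrU hx))).differentiableAt (by norm_num)).hasFDerivAt) hLip
  obtain ⟨A, L, R, hA, hL, hR, h⟩ := local_aux g x0 (fderiv ℝ g) H c r ε L0 A0 hc0 hL00 hA00 hc hε hε0
    (fun x hx y hy => hb1 x (hrr1 hx) y (hrr1 hy)) hdist2 hbd hTay
  exact ⟨r, A, L, R, hr0, hA, hL, hR, hrU, h⟩

lemma le_zNorm {n : ℕ} (q : Fin n → ℤ) (i : Fin n) : |(q i : ℝ)| ≤ zNorm q := by
  unfold zNorm
  have h : (q i).natAbs ≤ Finset.univ.sup fun i => (q i).natAbs :=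
    Finset.le_sup (f := fun i => (q i).natAbs) (Finset.mem_univ i)
  have h2 : |(q i : ℝ)| = ((q i).natAbs : ℝ) := by
    rw [Nat.cast_natAbs, Int.cast_abs]
  rw [h2]; exact_mod_cast h

lemma exists_zNorm {n : ℕ} (hn : 0 < n) (q : Fin n → ℤ) : ∃ i, |(q i : ℝ)| = zNorm q := by
  unfold zNorm
  have : Nonempty (Fin n) := ⟨⟨0, hn⟩⟩
  obtain ⟨i, -, hi⟩ := Finset.exists_mem_eq_sup (Finset.univ : Finset (Fin n))
    Finset.univ_nonempty (fun i => (q i).natAbs)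
  refine ⟨i, ?_⟩
  rw [hi, Nat.cast_natAbs, Int.cast_abs]

lemma one_le_zNorm {n : ℕ} (q : Fin n → ℤ) (hq : q ≠ 0) : 1 ≤ zNorm q := by
  obtain ⟨i, hi⟩ := Function.ne_iff.1 hq
  refine le_trans ?_ (le_zNorm q i)
  have : 1 ≤ |q i| := Int.one_le_abs hi
  exact_mod_cast this

/-- first block of coordinates, normalised -/
def qa {n l : ℕ} (q : Fin n → ℤ) (j : Fin (n - l)) : ℝ :=
  (q ⟨j, by omega⟩ : ℝ) / zNorm q

/-- second block of coordinates, normalised -/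
def qb {n l : ℕ} (hln : l < n) (q : Fin n → ℤ) (u : Fin l) : ℝ :=
  (q ⟨n - l + u, by omega⟩ : ℝ) / zNorm q

lemma split_sum {n l : ℕ} (hln : l < n) (q : Fin n → ℤ) (hq : q ≠ 0) (x : Fin (n - l) → ℝ)
    (z : Fin l → ℝ) : ∑ i, (q i : ℝ) * graphMap x z i =
      zNorm q * (lform (qa q) x + lform (qb hln q) z) := by
  have hz : zNorm q ≠ 0 := by have := one_le_zNorm q hq; linarith
  have h : n - l + l = n := by omega
  rw [← Fin.sum_congr' (fun i => (q i : ℝ) * graphMap x z i) h, Fin.sum_univ_add]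
  rw [lform_apply, lform_apply, mul_add, Finset.mul_sum, Finset.mul_sum]
  congr 1
  · refine Finset.sum_congr rfl fun j _ => ?_
    have h1 : graphMap (n := n) x z (Fin.cast h (Fin.castAdd l j)) = x j := by
      simp [graphMap]
    rw [h1]
    have h2 : q (Fin.cast h (Fin.castAdd l j)) = q ⟨j, by omega⟩ := by congr 1
    rw [h2]; unfold qa; field_simp
  · refine Finset.sum_congr rfl fun j _ => ?_
    have h1 : graphMap (n := n) x z (Fin.cast h (Fin.natAdd (n - l) j)) = z j := by
      simp [graphMap]
    rw [h1]
    have h2 : q (Fin.cast h (Fin.natAdd (n - l) j)) = q ⟨n - l + j, by omega⟩ := by congr 1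
    rw [h2]; unfold qb; field_simp

lemma q_norms {n l : ℕ} (hln : l < n) (q : Fin n → ℤ) (hq : q ≠ 0) :
    ‖(qa q : Fin (n - l) → ℝ)‖ ≤ 1 ∧ ‖(qb hln q : Fin l → ℝ)‖ ≤ 1 ∧
    (‖(qa q : Fin (n - l) → ℝ)‖ = 1 ∨ ‖(qb hln q : Fin l → ℝ)‖ = 1) := by
  have hz1 := one_le_zNorm q hq
  have hz : 0 < zNorm q := by linarith
  have key : ∀ i, ‖(q i : ℝ) / zNorm q‖ ≤ 1 := fun i => by
    rw [norm_div, Real.norm_eq_abs, Real.norm_eq_abs, abs_of_pos hz, div_le_one hz]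
    exact le_zNorm q i
  have ha : ‖(qa q : Fin (n - l) → ℝ)‖ ≤ 1 :=
    (pi_norm_le_iff_of_nonneg zero_le_one).2 fun j => key _
  have hb : ‖(qb hln q : Fin l → ℝ)‖ ≤ 1 :=
    (pi_norm_le_iff_of_nonneg zero_le_one).2 fun j => key _
  refine ⟨ha, hb, ?_⟩
  obtain ⟨i, hi⟩ := exists_zNorm (by omega) q
  have h1 : ‖(q i : ℝ) / zNorm q‖ = 1 := by
    rw [norm_div, Real.norm_eq_abs, Real.norm_eq_abs, abs_of_pos hz, hi, div_self hz.ne']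
  by_cases h : (i : ℕ) < n - l
  · left
    refine le_antisymm ha ?_
    rw [← h1]
    exact norm_le_pi_norm (qa q : Fin (n - l) → ℝ) ⟨i, h⟩
  · right
    refine le_antisymm hb ?_
    rw [← h1]
    have h2 := norm_le_pi_norm (qb hln q : Fin l → ℝ) ⟨i - (n - l), by omega⟩
    have h3 : (⟨n - l + (i - (n - l)), by omega⟩ : Fin n) = i := by
      apply Fin.ext; simp only; omega
    unfold qb at h2 ⊢
    simp only [h3] at h2
    exact h2

lemma term_eq {n l : ℕ} (hln : l < n) (Q ψ : ℝ) (hQ : 0 < Q) (hψ : 0 < ψ) (F : ℝ) :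
    Q * (1 / (ψ / Q)) ^ (n - l - 1) * F =
      Q ^ ((n : ℝ) - l) * ψ ^ ((l : ℝ) + 1 - n) * F := by
  obtain ⟨k, hk⟩ : ∃ k, n = l + 1 + k := ⟨n - l - 1, by omega⟩
  have h1 : n - l - 1 = k := by omega
  have h2 : (n : ℝ) - l = k + 1 := by rw [hk]; push_cast; ring
  have h3 : (l : ℝ) + 1 - n = -k := by rw [hk]; push_cast; ring
  rw [h1, h2, h3, Real.rpow_neg hψ.le, Real.rpow_natCast]
  rw [show (k : ℝ) + 1 = ((k + 1 : ℕ) : ℝ) by push_cast; ring, Real.rpow_natCast]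
  rw [one_div_div, div_pow, pow_succ]
  field_simp

lemma finite_p (a ψ : ℝ) : {p : ℤ | |a + p| < ψ}.Finite := by
  refine (Set.finite_Icc ⌊-ψ - a⌋ ⌈ψ - a⌉).subset fun p hp => ?_
  rw [Set.mem_setOf_eq, abs_lt] at hp
  constructor
  · exact_mod_cast (Int.floor_le _).trans (by linarith [hp.1] : -ψ - a ≤ p)
  · exact_mod_cast (by linarith [hp.2] : (p : ℝ) ≤ ψ - a).trans (Int.le_ceil _)

/-- points of the dual set satisfy the inequality for infinitely many `q` -/
lemma infinite_q {n : ℕ} (θ : ℝ) (Ψ : (Fin n → ℤ) → ℝ) (y : Fin n → ℝ)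
    (hy : y ∈ dualApprox n θ Ψ) :
    {q : Fin n → ℤ | ∃ p : ℤ, |(∑ i, (q i : ℝ) * y i) + p + θ| < Ψ q}.Infinite := by
  intro hfin
  apply hy
  have : {pq : ℤ × (Fin n → ℤ) | |(∑ i, (pq.2 i : ℝ) * y i) + (pq.1 : ℝ) + θ| < Ψ pq.2} ⊆
      ⋃ q ∈ {q : Fin n → ℤ | ∃ p : ℤ, |(∑ i, (q i : ℝ) * y i) + p + θ| < Ψ q},
        (fun p : ℤ => (p, q)) '' {p : ℤ | |((∑ i, (q i : ℝ) * y i) + θ) + p| < Ψ q} := by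
    rintro ⟨p, q⟩ hpq
    simp only [Set.mem_setOf_eq] at hpq
    simp only [Set.mem_iUnion]
    refine ⟨q, ⟨p, hpq⟩, p, ?_, rfl⟩
    rw [Set.mem_setOf_eq, add_right_comm]; exact hpq
  exact (hfin.biUnion fun q _ => (finite_p _ _).image _).subset this

lemma local_null (n l : ℕ) (hln : l < n)
    (U : Set (Fin (n - l) → ℝ)) (hUopen : IsOpen U)
    (g : (Fin (n - l) → ℝ) → (Fin l → ℝ)) (hg : ContDiffOn ℝ 2 g U)
    (θ : ℝ) (Ψ : (Fin n → ℤ) → ℝ) (hΨpos : ∀ q, 0 ≤ Ψ q)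
    (hΨlim : Tendsto Ψ cofinite (nhds 0))
    (f : ℝ → ℝ) (hfmono : MonotoneOn f (Set.Ici 0))
    (hfpos : ∀ r : ℝ, 0 ≤ r → 0 ≤ f r)
    (s C : ℝ) (hs : s < 2 * ((n : ℝ) - l - 1)) (hC : 0 < C)
    (hI : ∀ x y : ℝ, 0 < y → y < 1 → 1 < x → f (x * y) ≤ C * x ^ s * f y)
    (x0 : Fin (n - l) → ℝ) (hx0 : x0 ∈ U)
    (hII : ∀ s : Fin l → ℝ, s ≠ 0 → IsUnit (Lambda g s x0))
    (hconv : Summable fun q : {q : Fin n → ℤ // q ≠ 0} =>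
      zNorm q.1 ^ ((n : ℝ) - l) * Ψ q.1 ^ ((l : ℝ) + 1 - n) *
        f (Ψ q.1 / zNorm q.1)) :
    ∃ r > 0, hausdorffGauge f
      (Metric.ball x0 r ∩ {x | graphMap x (g x) ∈ dualApprox n θ Ψ}) = 0 := by
  obtain ⟨r, A, L, R, hr, hA, hL, hR, -, hG⟩ := local_structure U hUopen g hg x0 hx0 hII
  have hs' : s < 2 * (((n - l : ℕ) : ℝ) - 1) := by
    rw [Nat.cast_sub hln.le]; exact hs
  obtain ⟨K, C0, hK, hC0, hcov⟩ := cover_bound (n - l) (by omega) A L R C s hA hL hR hC hs'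
  refine ⟨r, hr, gauge_null f hfmono _ fun D hD μ hμ => ?_⟩
  set η : ℝ := min (1 / 2) (D ^ 2 / C0 ^ 2) with hη
  have hη0 : 0 < η := by positivity
  have hbad : {q : Fin n → ℤ | ¬ Ψ q < η}.Finite :=
    Filter.eventually_cofinite.1 (hΨlim.eventually (gt_mem_nhds hη0))
  let T : {q : Fin n → ℤ // q ≠ 0} → Set (Fin (n - l) → ℝ) := fun q =>
    {x | Ψ q.1 < η ∧ x ∈ Metric.ball x0 r ∧
      ∃ p : ℤ, |zNorm q.1 * (lform (qa q.1) x + lform (qb hln q.1) (g x)) + p + θ| < Ψ q.1}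
  have hTerm0 : ∀ q : {q : Fin n → ℤ // q ≠ 0}, 0 ≤ zNorm q.1 ^ ((n : ℝ) - l) *
      Ψ q.1 ^ ((l : ℝ) + 1 - n) * f (Ψ q.1 / zNorm q.1) := by
    intro q
    have h1 := one_le_zNorm q.1 q.2
    have h2 := hΨpos q.1
    have h3 := hfpos (Ψ q.1 / zNorm q.1) (by positivity)
    positivity
  have hT : ∀ q, μ (T q) ≤ ENNReal.ofReal (K * (zNorm q.1 ^ ((n : ℝ) - l) *
      Ψ q.1 ^ ((l : ℝ) + 1 - n) * f (Ψ q.1 / zNorm q.1))) := by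
    intro q
    by_cases h1 : Ψ q.1 < η
    swap
    · have : T q = ∅ := by ext x; simp [T, h1]
      rw [this]; simp
    rcases (hΨpos q.1).eq_or_lt with h0 | h0
    · have : T q = ∅ := by
        ext x
        simp only [T, Set.mem_setOf_eq, Set.mem_empty_iff_false, iff_false, not_and, not_exists,
          not_lt, ← h0]
        intros; exact abs_nonneg _
      rw [this]; simp
    have hQ1 := one_le_zNorm q.1 q.2
    have hQ0 : 0 < zNorm q.1 := by linarith
    obtain ⟨ha, hb, hab⟩ := q_norms hln q.1 q.2
    obtain ⟨G', hG1, hG2, hG3⟩ := hG _ _ ha hb hab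
    have hδ : C0 ^ 2 * (Ψ q.1 / zNorm q.1) ≤ D ^ 2 := by
      have h2 : Ψ q.1 / zNorm q.1 ≤ D ^ 2 / C0 ^ 2 :=
        (div_le_self h0.le hQ1).trans (h1.le.trans (min_le_right _ _))
      rw [le_div_iff₀ (by positivity)] at h2
      linarith
    have h := hcov f D μ hfmono hfpos hI hD hμ (Metric.ball x0 r)
      (fun y => lform (qa q.1) y + lform (qb hln q.1) (g y)) G' hG1 hG2 hG3 (zNorm q.1) (Ψ q.1) θ
      (Ψ q.1 / zNorm q.1) hQ1 h0 (h1.le.trans (min_le_left _ _)) rfl hδ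
    rw [term_eq hln _ _ hQ0 h0] at h
    exact (measure_mono fun x hx => hx.2).trans h
  have hsum : ∑' q, μ (T q) ≠ ⊤ := by
    refine ne_top_of_le_ne_top ?_ (ENNReal.tsum_le_tsum hT)
    rw [← ENNReal.ofReal_tsum_of_nonneg (fun q => mul_nonneg hK.le (hTerm0 q))
      (hconv.mul_left K)]
    exact ENNReal.ofReal_ne_top
  refine measure_mono_null ?_ (measure_limsup_cofinite_eq_zero hsum)
  rintro x ⟨hxb, hx⟩
  rw [Filter.mem_limsup_iff_frequently_mem, Filter.frequently_cofinite_iff_infinite]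
  have hinf := infinite_q θ Ψ _ hx
  intro hfin
  refine (hinf.diff (hbad.union (Set.finite_singleton 0))) ?_
  refine (hfin.image Subtype.val).subset ?_
  rintro q ⟨⟨p, hp⟩, hq⟩
  simp only [Set.mem_union, Set.mem_setOf_eq, not_not, Set.mem_singleton_iff, not_or] at hq
  refine ⟨⟨q, hq.2⟩, ⟨hq.1, hxb, p, ?_⟩, rfl⟩
  rw [split_sum hln q hq.2] at hp
  exact hp

lemma graph_lip {n l : ℕ} (g : (Fin (n - l) → ℝ) → (Fin l → ℝ)) (t : Set (Fin (n - l) → ℝ))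
    (K : NNReal) (h : LipschitzOnWith K g t) : ∀ x ∈ t, ∀ y ∈ t,
    dist (graphMap (n := n) x (g x)) (graphMap y (g y)) ≤ (K + 2 : ℝ) * dist x y := by
  intro x hx y hy
  have h1 := h.dist_le_mul x hx y hy
  have h0 : 0 ≤ dist x y := dist_nonneg
  have hK : 0 ≤ (K : ℝ) := K.2
  have hK2 : 0 ≤ (K : ℝ) * dist x y := by positivity
  refine (dist_pi_le_iff (by positivity)).2 fun i => ?_
  unfold graphMap
  split_ifs with h3 h4
  · have := dist_le_pi_dist x y ⟨i, h3⟩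
    rw [add_mul]; linarith
  · have := dist_le_pi_dist (g x) (g y) ⟨(i : ℕ) - (n - l), h4⟩
    rw [add_mul]; linarith
  · rw [dist_self]; positivity

theorem stmt0
    (n l : ℕ) (hn : 2 ≤ n) (hl : 1 ≤ l) (hln : l < n)
    (U : Set (Fin (n - l) → ℝ)) (hUopen : IsOpen U) (hUconn : IsConnected U)
    (hUbdd : Bornology.IsBounded U)
    (g : (Fin (n - l) → ℝ) → (Fin l → ℝ)) (hg : ContDiffOn ℝ 2 g U)
    (M : Set (Fin n → ℝ)) (hM : M = { y | ∃ x ∈ U, y = graphMap x (g x) })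
    (θ : ℝ)
    (Ψ : (Fin n → ℤ) → ℝ) (hΨpos : ∀ q, 0 ≤ Ψ q)
    (hΨlim : Tendsto Ψ cofinite (nhds 0))
    (f : ℝ → ℝ) (hfmono : MonotoneOn f (Set.Ici 0))
    (hfcont : ContinuousOn f (Set.Ici 0)) (hf0 : f 0 = 0)
    (hfpos : ∀ r : ℝ, 0 ≤ r → 0 ≤ f r)
    (hI : ∃ s : ℝ, s < 2 * ((n : ℝ) - l - 1) ∧ ∃ C : ℝ, 0 < C ∧
      ∀ x y : ℝ, 0 < y → y < 1 → 1 < x → f (x * y) ≤ C * x ^ s * f y)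
    (S : Set (Fin (n - l) → ℝ)) (hSU : S ⊆ U)
    (hSnull : hausdorffGauge f S = 0)
    (hII : ∀ s : Fin l → ℝ, s ≠ 0 → ∀ x ∈ U \ S, IsUnit (Lambda g s x))
    (hconv : Summable fun q : {q : Fin n → ℤ // q ≠ 0} =>
      zNorm q.1 ^ ((n : ℝ) - l) * Ψ q.1 ^ ((l : ℝ) + 1 - n) *
        f (Ψ q.1 / zNorm q.1)) :
    hausdorffGauge f (dualApprox n θ Ψ ∩ M) = 0 := by
  obtain ⟨s, hs, C, hC, hI⟩ := hI
  set W : Set (Fin (n - l) → ℝ) := {x | x ∈ U ∧ graphMap x (g x) ∈ dualApprox n θ Ψ} with hW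
  have hWS : hausdorffGauge f (W \ S) = 0 := by
    refine measure_null_of_locally_null _ fun x hx => ?_
    obtain ⟨r, hr, h⟩ := local_null n l hln U hUopen g hg θ Ψ hΨpos hΨlim f hfmono hfpos s C hs hC
      hI x hx.1.1 (fun s hs => hII s hs x ⟨hx.1.1, hx.2⟩) hconv
    refine ⟨Metric.ball x r ∩ (W \ S), Filter.inter_mem
      (mem_nhdsWithin_of_mem_nhds (Metric.ball_mem_nhds x hr)) self_mem_nhdsWithin, ?_⟩
    refine measure_mono_null ?_ h
    exact fun y hy => ⟨hy.1, hy.2.1.2⟩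
  have hWnull : hausdorffGauge f W = 0 := by
    refine measure_mono_null (t := (W \ S) ∪ S) (fun x hx => ?_)
      (measure_union_null hWS hSnull)
    by_cases h : x ∈ S
    · exact Or.inr h
    · exact Or.inl ⟨hx, h⟩
  let φ : (Fin (n - l) → ℝ) → (Fin n → ℝ) := fun x => graphMap x (g x)
  have himg : (OuterMeasure.comap φ (hausdorffGauge f).toOuterMeasure) W = 0 := by
    refine measure_null_of_locally_null _ fun x hx => ?_
    have hgx : ContDiffAt ℝ 1 g x := (hg.contDiffAt (hUopen.mem_nhds hx.1)).of_le (by norm_num)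
    obtain ⟨K, t, ht, hlip⟩ := hgx.exists_lipschitzOnWith
    refine ⟨t ∩ W, Filter.inter_mem (mem_nhdsWithin_of_mem_nhds ht) self_mem_nhdsWithin, ?_⟩
    rw [OuterMeasure.comap_apply]
    refine gauge_lipschitz f hfmono hf0 s C hC hI φ (t ∩ W) (K + 2) ?_ ?_ ?_
    · have : 0 ≤ (K : ℝ) := K.2
      linarith
    · intro a ha b hb
      exact graph_lip g t K hlip a ha.1 b hb.1
    · exact measure_mono_null Set.inter_subset_right hWnull
  rw [OuterMeasure.comap_apply] at himg
  refine measure_mono_null ?_ himg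
  rintro y ⟨hy, hyM⟩
  rw [hM] at hyM
  obtain ⟨x, hx, rfl⟩ := hyM
  exact ⟨x, ⟨hx, hy⟩, rfl⟩
end
end

section
/- Let n > l ≥ 1 be integers and suppose (l, n) is a good pair. Then for every integer t with 0 ≤ t ≤ l − 1, the pair (l − t, n − t) is also a good pair. -/
noncomputable section

/-- `(l, n)` is a *good pair* if there is a connected bounded open set
`U ⊆ ℝ^{n-l}` and a `C²` map `g : U → ℝ^l` such that `Λ(g,s,x)` is invertible
for every nonzero `s ∈ ℝ^l` and every `x ∈ U`. -/
def IsGoodPair (l n : ℕ) : Prop :=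
  ∃ (U : Set (Fin (n - l) → ℝ)) (g : (Fin (n - l) → ℝ) → (Fin l → ℝ)),
    IsOpen U ∧ IsConnected U ∧ Bornology.IsBounded U ∧ ContDiffOn ℝ 2 g U ∧
    ∀ s : Fin l → ℝ, s ≠ 0 → ∀ x ∈ U, IsUnit (Lambda g s x)

theorem good_aux {l m k m' : ℕ} (hk : k ≤ l) (hm : m' = m)
    (h : ∃ (U : Set (Fin m → ℝ)) (g : (Fin m → ℝ) → (Fin l → ℝ)),
    IsOpen U ∧ IsConnected U ∧ Bornology.IsBounded U ∧ ContDiffOn ℝ 2 g U ∧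
    ∀ s : Fin l → ℝ, s ≠ 0 → ∀ x ∈ U, IsUnit (Lambda g s x)) :
    ∃ (U : Set (Fin m' → ℝ)) (g : (Fin m' → ℝ) → (Fin k → ℝ)),
    IsOpen U ∧ IsConnected U ∧ Bornology.IsBounded U ∧ ContDiffOn ℝ 2 g U ∧
    ∀ s : Fin k → ℝ, s ≠ 0 → ∀ x ∈ U, IsUnit (Lambda g s x) := by
  subst hm
  obtain ⟨r, rfl⟩ := Nat.exists_eq_add_of_le hk
  obtain ⟨U, g, h1, h2, h3, h4, h5⟩ := h
  refine ⟨U, fun x u => g x (Fin.castAdd r u), h1, h2, h3, ?_, ?_⟩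
  · rw [contDiffOn_pi] at h4 ⊢
    exact fun u => h4 (Fin.castAdd r u)
  · intro s hs x hx
    have key := h5 (Fin.append s 0) ?_ x hx
    · convert key using 1
      ext j i
      simp [Lambda, Fin.sum_univ_add, secondPartial]
    · intro h0
      apply hs
      ext u
      simpa using congrFun h0 (Fin.castAdd r u)

theorem stmt4 (l n : ℕ) (hl : 1 ≤ l) (hln : l < n) (h : IsGoodPair l n) :
    ∀ t : ℕ, t ≤ l - 1 → IsGoodPair (l - t) (n - t) := by
  intro t ht
  exact good_aux (Nat.sub_le l t) (by omega) h
end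
end

section
/- Let n > l ≥ 1 be integers and suppose (l, n) is a good pair. Then for every integer t ≥ 0, the pair (l, n + t(n − l)) is also a good pair. -/
noncomputable section

/-- Restriction of a vector to its `k`-th block of coordinates. -/
def blockProj {M m T : ℕ} (e : Fin M ≃ Fin m × Fin T) (k : Fin T) :
    (Fin M → ℝ) →L[ℝ] (Fin m → ℝ) :=
  ContinuousLinearMap.pi fun i => ContinuousLinearMap.proj (e.symm (i, k))

theorem blockProj_apply {M m T : ℕ} (e : Fin M ≃ Fin m × Fin T) (k : Fin T)
    (x : Fin M → ℝ) (i : Fin m) : blockProj e k x i = x (e.symm (i, k)) := rfl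

theorem blockProj_single {M m T : ℕ} (e : Fin M ≃ Fin m × Fin T) (k : Fin T)
    (a : Fin M) : blockProj e k (Pi.single a 1) =
      if (e a).2 = k then Pi.single (e a).1 1 else 0 := by
  obtain ⟨⟨i, j⟩, rfl⟩ := e.symm.surjective a
  ext i'
  rw [blockProj_apply]
  by_cases h : j = k
  · subst h
    by_cases h' : i' = i
    · subst h'; simp
    · simp [h']
  · have : ¬ k = j := fun h' => h h'.symm
    simp [h, this]

theorem iterated_comp {m M : ℕ} {f : (Fin m → ℝ) → ℝ} {U : Set (Fin m → ℝ)}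
    (hU : IsOpen U) (hf : ContDiffOn ℝ 2 f U) (p : (Fin M → ℝ) →L[ℝ] (Fin m → ℝ))
    {x : Fin M → ℝ} (hx : p x ∈ U) (v w : Fin M → ℝ) :
    iteratedFDeriv ℝ 2 (fun y => f (p y)) x ![v, w] =
      iteratedFDeriv ℝ 2 f (p x) ![p v, p w] := by
  have hV : IsOpen (p ⁻¹' U) := hU.preimage p.continuous
  have h := p.iteratedFDerivWithin_comp_right hf hU.uniqueDiffOn hV.uniqueDiffOn hx
    (i := 2) le_rfl
  rw [iteratedFDerivWithin_of_isOpen 2 hV hx, iteratedFDerivWithin_of_isOpen 2 hU hx] at h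
  change iteratedFDeriv ℝ 2 (f ∘ p) x ![v, w] = _
  rw [h, ContinuousMultilinearMap.compContinuousLinearMap_apply]
  congr 1
  ext a
  fin_cases a <;> rfl

theorem good_blocks {l m M T : ℕ} (e : Fin M ≃ Fin m × Fin T)
    (h : ∃ (U : Set (Fin m → ℝ)) (g : (Fin m → ℝ) → (Fin l → ℝ)),
      IsOpen U ∧ IsConnected U ∧ Bornology.IsBounded U ∧ ContDiffOn ℝ 2 g U ∧
      ∀ s : Fin l → ℝ, s ≠ 0 → ∀ x ∈ U, IsUnit (Lambda g s x)) :
    ∃ (U : Set (Fin M → ℝ)) (g : (Fin M → ℝ) → (Fin l → ℝ)),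
      IsOpen U ∧ IsConnected U ∧ Bornology.IsBounded U ∧ ContDiffOn ℝ 2 g U ∧
      ∀ s : Fin l → ℝ, s ≠ 0 → ∀ x ∈ U, IsUnit (Lambda g s x) := by
  obtain ⟨U, g, hU, hc, hb, hg, hL⟩ := h
  have hgk : ∀ k, ContDiffOn ℝ 2 (fun x => g (blockProj e k x)) (blockProj e k ⁻¹' U) :=
    fun k => hg.comp (blockProj e k).contDiff.contDiffOn (fun x hx => hx)
  refine ⟨⋂ k, blockProj e k ⁻¹' U, fun x => ∑ k, g (blockProj e k x), ?_, ?_, ?_, ?_, ?_⟩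
  · exact isOpen_iInter_of_finite fun k => hU.preimage (blockProj e k).continuous
  · have h1 : IsConnected (Set.pi Set.univ fun _ : Fin T => U) :=
      isConnected_univ_pi.2 fun _ => hc
    have h2 := h1.image (fun w a => w (e a).2 (e a).1)
      (Continuous.continuousOn (by fun_prop))
    convert h2
    ext x
    simp only [Set.mem_iInter, Set.mem_preimage, Set.mem_image, Set.mem_pi, Set.mem_univ,
      true_imp_iff]
    constructor
    · intro hx
      refine ⟨fun k => blockProj e k x, hx, ?_⟩
      ext a
      simp [blockProj_apply]
    · rintro ⟨w, hw, rfl⟩ k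
      convert hw k using 1
      ext i
      simp [blockProj_apply]
  · obtain ⟨C, hC⟩ := isBounded_iff_forall_norm_le.1 hb
    obtain ⟨y, hy⟩ := hc.nonempty
    have hC0 : 0 ≤ C := (norm_nonneg _).trans (hC y hy)
    refine isBounded_iff_forall_norm_le.2 ⟨C, fun x hx => ?_⟩
    refine (pi_norm_le_iff_of_nonneg hC0).2 fun a => ?_
    have := (norm_le_pi_norm (blockProj e (e a).2 x) (e a).1).trans
      (hC _ (Set.mem_iInter.1 hx (e a).2))
    simpa [blockProj_apply] using this
  · exact ContDiffOn.sum fun k _ => (hgk k).mono (Set.iInter_subset _ k)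
  · intro s hs x hx
    have hx' : ∀ k, blockProj e k x ∈ U := fun k => Set.mem_iInter.1 hx k
    have key : Lambda (fun x => ∑ k, g (blockProj e k x)) s x =
        (Matrix.blockDiagonal fun k => Lambda g s (blockProj e k x)).submatrix e e := by
      ext b a
      rw [Matrix.submatrix_apply, Matrix.blockDiagonal_apply]
      simp only [Lambda, Matrix.of_apply, secondPartial]
      have hsum : ∀ u, iteratedFDeriv ℝ 2 (fun y => (∑ k, g (blockProj e k y)) u) x
          ![Pi.single a 1, Pi.single b 1] =
          if (e b).2 = (e a).2 then iteratedFDeriv ℝ 2 (fun y => g y u) (blockProj e (e b).2 x)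
            ![Pi.single (e a).1 1, Pi.single (e b).1 1] else 0 := by
        intro u
        have hgu : ContDiffOn ℝ 2 (fun y => g y u) U := contDiffOn_pi.1 hg u
        have hat : ∀ k ∈ (Finset.univ : Finset (Fin T)),
            ContDiffAt ℝ (2 : ℕ) (fun y => g (blockProj e k y) u) x := fun k _ =>
          (contDiffOn_pi.1 (hgk k) u).contDiffAt
            ((hU.preimage (blockProj e k).continuous).mem_nhds (hx' k))
        simp only [Finset.sum_apply]
        rw [iteratedFDeriv_fun_sum_apply hat, ContinuousMultilinearMap.sum_apply]
        simp only [fun k => iterated_comp hU hgu (blockProj e k) (hx' k), blockProj_single]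
        rw [Finset.sum_eq_single (e b).2]
        · by_cases h1 : (e b).2 = (e a).2
          · simp [h1]
          · have h2 : ¬ (e a).2 = (e b).2 := fun h => h1 h.symm
            rw [if_neg h1]
            exact ContinuousMultilinearMap.map_coord_zero _ 0 (by simp [h2])
        · intro k _ hk
          exact ContinuousMultilinearMap.map_coord_zero _ 1 (by simp [hk.symm])
        · simp
      simp only [hsum]
      split_ifs <;> simp
    rw [key, Matrix.isUnit_submatrix_equiv, Matrix.isUnit_iff_isUnit_det,
      Matrix.det_blockDiagonal]
    exact (IsUnit.prod_univ_iff).2 fun k =>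
      (Matrix.isUnit_iff_isUnit_det _).1 (hL s hs _ (hx' k))

theorem stmt5 (l n : ℕ) (hl : 1 ≤ l) (hln : l < n) (h : IsGoodPair l n) :
    ∀ t : ℕ, IsGoodPair l (n + t * (n - l)) := by
  intro t
  have hM : n + t * (n - l) - l = (n - l) * (t + 1) := by
    rw [mul_add, mul_one, mul_comm (n - l) t]; omega
  exact good_blocks ((finCongr hM).trans finProdFinEquiv.symm) h
end
end

section
/- Let l ≥ 2 and let m ≥ 1 be an odd integer. Then for every family A_1,…,A_l of real symmetric m×m matrices there exists a nonzero vector s = (s_1,…,s_l) ∈ ℝ^l such that det(∑_{u=1}^{l} s_u A_u) = 0. Consequently, if l ≥ 2 and n − l is odd, then (l, n) is not a good pair. -/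
noncomputable section

theorem exists_det_zero (l m : ℕ) (hl : 2 ≤ l) (hm : Odd m)
    (A : Fin l → Matrix (Fin m) (Fin m) ℝ) :
    ∃ s : Fin l → ℝ, s ≠ 0 ∧ (∑ u, s u • A u).det = 0 := by
  let a : Fin l := ⟨0, by omega⟩
  let b : Fin l := ⟨1, by omega⟩
  have hab : a ≠ b := by simp [a, b]
  let s : ℝ → Fin l → ℝ := fun t u =>
    if u = a then Real.cos t else if u = b then Real.sin t else 0
  have hsa : ∀ t, s t a = Real.cos t := fun t => by simp [s]
  have hsb : ∀ t, s t b = Real.sin t := fun t => by simp [s, hab.symm]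
  have hs : ∀ t, s t ≠ 0 := by
    intro t h
    have h1 := hsa t
    have h2 := hsb t
    rw [h] at h1 h2
    have := Real.sin_sq_add_cos_sq t
    rw [← h1, ← h2] at this
    simp at this
  have hc : Continuous fun t => (∑ u, s t u • A u).det := by
    apply Continuous.matrix_det
    refine continuous_finsetSum _ fun u _ => ?_
    have hA : Continuous fun _ : ℝ => A u := continuous_const
    suffices hq : Continuous fun t => s t u from hq.smul hA
    by_cases h1 : u = a
    · simpa [s, h1] using Real.continuous_cos
    · by_cases h2 : u = b
      · simpa [s, h2, hab.symm] using Real.continuous_sin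
      · simp [s, h1, h2, continuous_const]
  have hneg : (∑ u, s Real.pi u • A u).det = -(∑ u, s 0 u • A u).det := by
    have : (∑ u, s Real.pi u • A u) = -(∑ u, s 0 u • A u) := by
      rw [← Finset.sum_neg_distrib]
      refine Finset.sum_congr rfl fun u _ => ?_
      rw [← neg_smul]
      congr 1
      simp only [s]
      split_ifs <;> simp
    rw [this, Matrix.det_neg, Fintype.card_fin, hm.neg_one_pow]
    ring
  have key : (0 : ℝ) ∈ Set.range fun t => (∑ u, s t u • A u).det := by
    rcases le_total (∑ u, s 0 u • A u).det 0 with h | h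
    · exact mem_range_of_exists_le_of_exists_ge hc ⟨0, h⟩ ⟨Real.pi, by rw [hneg]; linarith⟩
    · exact mem_range_of_exists_le_of_exists_ge hc ⟨Real.pi, by rw [hneg]; linarith⟩ ⟨0, h⟩
  obtain ⟨t, ht⟩ := key
  exact ⟨s t, hs t, ht⟩

theorem stmt6 (l m : ℕ) (hl : 2 ≤ l) (hm : Odd m) (hm1 : 1 ≤ m) :
    (∀ A : Fin l → Matrix (Fin m) (Fin m) ℝ, (∀ u, (A u).IsSymm) →
      ∃ s : Fin l → ℝ, s ≠ 0 ∧ (∑ u, s u • A u).det = 0) ∧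
    (∀ n : ℕ, l < n → Odd (n - l) → ¬ IsGoodPair l n) := by
  refine ⟨fun A _ => exists_det_zero l m hl hm A, ?_⟩
  rintro n hn hodd ⟨U, g, -, hU, -, -, h⟩
  obtain ⟨x, hx⟩ := hU.nonempty
  obtain ⟨s, hs, hdet⟩ := exists_det_zero l (n - l) hl hodd
    (fun u => Matrix.of fun j i => secondPartial g u x i j)
  have h1 := h s hs x hx
  have h2 : Lambda g s x = ∑ u, s u • (Matrix.of fun j i => secondPartial g u x i j) := by
    ext j i
    simp [Lambda, Matrix.sum_apply]
  rw [h2, Matrix.isUnit_iff_isUnit_det, hdet] at h1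
  exact not_isUnit_zero h1
end
end

section
/- Let l ≥ 1 and let m be an integer with 1 ≤ m < l. Then for every family A_1,…,A_l of real symmetric m×m matrices there exists a nonzero vector s = (s_1,…,s_l) ∈ ℝ^l such that the matrix ∑_{u=1}^{l} s_u A_u is singular; in fact s can be chosen so that the first row of ∑_{u=1}^{l} s_u A_u is the zero vector. Consequently, if n < 2l then (l, n) is not a good pair. -/
noncomputable section

theorem aux_row (l m : ℕ) (hm1 : 1 ≤ m) (hml : m < l) (A : Fin l → Matrix (Fin m) (Fin m) ℝ) :
    ∃ s : Fin l → ℝ, s ≠ 0 ∧ (∑ u, s u • A u).det = 0 ∧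
        ∀ j : Fin m, (∑ u, s u • A u) ⟨0, hm1⟩ j = 0 := by
  have hk : LinearMap.ker (Fintype.linearCombination ℝ (fun u => A u ⟨0, hm1⟩)) ≠ ⊥ :=
    LinearMap.ker_ne_bot_of_finrank_lt (by simpa using hml)
  obtain ⟨s, hs, hs0⟩ := (Submodule.ne_bot_iff _).1 hk
  have hrow : ∀ j : Fin m, (∑ u, s u • A u) ⟨0, hm1⟩ j = 0 := by
    intro j
    have h := congrFun (LinearMap.mem_ker.1 hs) j
    simpa [Fintype.linearCombination_apply, Matrix.sum_apply, Finset.sum_apply] using h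
  exact ⟨s, hs0, Matrix.det_eq_zero_of_row_eq_zero _ hrow, hrow⟩

theorem stmt7 (l m : ℕ) (hl : 1 ≤ l) (hm1 : 1 ≤ m) (hml : m < l) :
    (∀ A : Fin l → Matrix (Fin m) (Fin m) ℝ, (∀ u, (A u).IsSymm) →
      ∃ s : Fin l → ℝ, s ≠ 0 ∧ (∑ u, s u • A u).det = 0 ∧
        ∀ j : Fin m, (∑ u, s u • A u) ⟨0, hm1⟩ j = 0) ∧
    (∀ n : ℕ, l < n → n < 2 * l → ¬ IsGoodPair l n) := by
  refine ⟨fun A _ => aux_row l m hm1 hml A, ?_⟩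
  rintro n hln hn2 ⟨U, g, -, hU, -, -, h⟩
  obtain ⟨x, hx⟩ := hU.nonempty
  obtain ⟨s, hs0, hdet, -⟩ := aux_row l (n - l) (by omega) (by omega)
    (fun u => Matrix.of fun j i => secondPartial g u x i j)
  have hu := (Matrix.isUnit_iff_isUnit_det _).1 (h s hs0 x hx)
  have he : Lambda g s x = ∑ u, s u • (Matrix.of fun j i => secondPartial g u x i j) := by
    ext j i
    simp [Lambda, Matrix.sum_apply]
  rw [he, hdet] at hu
  exact not_isUnit_zero hu
end
end

section
/- Let n > l ≥ 1 be integers and set m = n − l. Suppose there exists a linear map M : ℝ^l → (m×m real matrices) such that M(z) is symmetric for every z ∈ ℝ^l, each entry M(z)_{ij} is identically equal to 0, to z_v, or to −z_v for some index v = v(i,j) ∈ {1,…,l}, and det M(z) ≠ 0 for every nonzero z ∈ ℝ^l. Then there exist quadratic forms g_1,…,g_l : ℝ^m → ℝ such that for every nonzero s = (s_1,…,s_l) ∈ ℝ^l and every x ∈ ℝ^m, the symmetric m×m matrix with (j,i) entry ∑_{u=1}^{l} s_u · ∂²g_u/∂x_i∂x_j (x) is invertible; in particular, (l, n) is a good pair.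 -/
noncomputable section

lemma secondPartial_quad {m l : ℕ} (g : (Fin m → ℝ) → (Fin l → ℝ)) (u : Fin l)
    (C : Matrix (Fin m) (Fin m) ℝ) (hC : ∀ i j, C i j = C j i)
    (hg : ∀ x, g x u = ∑ i, ∑ j, (C i j / 2) * x i * x j) (x : Fin m → ℝ) (a b : Fin m) :
    secondPartial g u x a b = C a b := by
  let p : Fin m → ((Fin m → ℝ) →L[ℝ] ℝ) := fun i => ContinuousLinearMap.proj i
  let L : (Fin m → ℝ) →L[ℝ] ((Fin m → ℝ) →L[ℝ] ℝ) :=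
    ∑ i, ∑ j, (p i).smulRight ((C i j) • p j)
  have h1 : ∀ y, HasFDerivAt (fun y => g y u) (L y) y := by
    intro y
    have hp : ∀ i, HasFDerivAt (fun x : Fin m → ℝ => x i) (p i) y := fun i => (p i).hasFDerivAt
    have h : HasFDerivAt (fun y : Fin m → ℝ => ∑ i, ∑ j, (C i j / 2) * (y i * y j))
        (∑ i, ∑ j, (C i j / 2) • (y i • p j + y j • p i)) y :=
      HasFDerivAt.fun_sum fun i _ => HasFDerivAt.fun_sum fun j _ =>
        ((hp i).mul (hp j)).const_mul _
    have e : (fun y => g y u) = fun y : Fin m → ℝ => ∑ i, ∑ j, (C i j / 2) * (y i * y j) := by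
      funext y
      simp only [hg, mul_assoc]
    rw [e]
    convert h using 1
    ext1 w
    simp only [L, p, _root_.sum_apply, ContinuousLinearMap.smulRight_apply,
      _root_.smul_apply, _root_.add_apply,
      ContinuousLinearMap.proj_apply, smul_eq_mul, mul_add, Finset.sum_add_distrib]
    have h2 : ∑ i, ∑ j, C i j / 2 * (y j * w i) = ∑ i, ∑ j, C i j / 2 * (y i * w j) := by
      rw [Finset.sum_comm]
      refine Finset.sum_congr rfl fun i _ => Finset.sum_congr rfl fun j _ => ?_
      rw [hC]
    rw [h2, ← Finset.sum_add_distrib]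
    refine Finset.sum_congr rfl fun i _ => ?_
    rw [← Finset.sum_add_distrib]
    refine Finset.sum_congr rfl fun j _ => ?_
    ring
  have h2 : fderiv ℝ (fun y => g y u) = L := funext fun y => (h1 y).fderiv
  rw [secondPartial, iteratedFDeriv_two_apply, h2, L.fderiv]
  simp [L, p, _root_.sum_apply, Pi.single_apply]

theorem stmt8 (l n : ℕ) (hl : 1 ≤ l) (hln : l < n)
    (Mz : (Fin l → ℝ) →ₗ[ℝ] Matrix (Fin (n - l)) (Fin (n - l)) ℝ)
    (hsymm : ∀ z, (Mz z).IsSymm)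
    (hentries : ∀ i j : Fin (n - l),
      (∀ z, Mz z i j = 0) ∨
        ∃ v : Fin l, (∀ z, Mz z i j = z v) ∨ (∀ z, Mz z i j = - z v))
    (hdet : ∀ z : Fin l → ℝ, z ≠ 0 → (Mz z).det ≠ 0) :
    (∃ g : (Fin (n - l) → ℝ) → (Fin l → ℝ),
      (∀ u : Fin l, ∃ C : Matrix (Fin (n - l)) (Fin (n - l)) ℝ,
        ∀ x, g x u = ∑ i, ∑ j, C i j * x i * x j) ∧
      ∀ s : Fin l → ℝ, s ≠ 0 → ∀ x : Fin (n - l) → ℝ, IsUnit (Lambda g s x)) ∧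
    IsGoodPair l n := by
  let g : (Fin (n - l) → ℝ) → (Fin l → ℝ) := fun x u =>
    ∑ i, ∑ j, (Mz (Pi.single u 1) i j / 2) * x i * x j
  have key : ∀ s : Fin l → ℝ, s ≠ 0 → ∀ x : Fin (n - l) → ℝ, IsUnit (Lambda g s x) := by
    intro s hs x
    have e : Lambda g s x = Mz s := by
      ext j i
      have hsum : s = ∑ u, s u • (Pi.single u 1 : Fin l → ℝ) := by
        ext v
        simp [Finset.sum_apply, Pi.single_apply]
      conv_rhs => rw [hsum, map_sum]
      simp only [Lambda, Matrix.of_apply, Matrix.sum_apply, map_smul, Matrix.smul_apply,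
        smul_eq_mul]
      refine Finset.sum_congr rfl fun u _ => ?_
      rw [secondPartial_quad g u (Mz (Pi.single u 1))
        (fun i j => (hsymm (Pi.single u 1)).apply j i) (fun x => rfl) x i j,
        (hsymm (Pi.single u 1)).apply j i]
    rw [e, Matrix.isUnit_iff_isUnit_det]
    exact (hdet s hs).isUnit
  refine ⟨⟨g, fun u => ⟨Matrix.of fun i j => Mz (Pi.single u 1) i j / 2, fun x => rfl⟩, key⟩, ?_⟩
  refine ⟨Metric.ball 0 1, g, Metric.isOpen_ball, ?_, Metric.isBounded_ball, ?_,
    fun s hs x _ => key s hs x⟩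
  · exact (convex_ball _ _).isConnected ⟨0, by simp⟩
  · apply ContDiff.contDiffOn
    simp only [g]
    fun_prop
end
end

section
/- For all real numbers z_1, z_2, z_3, the determinant of the symmetric 4×4 matrix M(z) with rows (z_1, z_2, z_3, −z_3), (z_2, −z_1, z_3, z_3), (z_3, z_3, z_1, z_2), (−z_3, z_3, z_2, −z_1) equals (z_1² + z_2²)² + 4 z_3⁴. In particular, det M(z) > 0 for every nonzero (z_1, z_2, z_3) ∈ ℝ³. -/
theorem stmt9 (z₁ z₂ z₃ : ℝ) :
    (!![z₁, z₂, z₃, -z₃;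
        z₂, -z₁, z₃, z₃;
        z₃, z₃, z₁, z₂;
        -z₃, z₃, z₂, -z₁]).det = (z₁ ^ 2 + z₂ ^ 2) ^ 2 + 4 * z₃ ^ 4 ∧
    ((z₁, z₂, z₃) ≠ (0, 0, 0) →
      0 < (!![z₁, z₂, z₃, -z₃;
              z₂, -z₁, z₃, z₃;
              z₃, z₃, z₁, z₂;
              -z₃, z₃, z₂, -z₁]).det) := by
  have h : (!![z₁, z₂, z₃, -z₃;
        z₂, -z₁, z₃, z₃;
        z₃, z₃, z₁, z₂;
        -z₃, z₃, z₂, -z₁]).det = (z₁ ^ 2 + z₂ ^ 2) ^ 2 + 4 * z₃ ^ 4 := by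
    simp [Matrix.det_succ_row_zero, Fin.sum_univ_succ, Fin.succAbove]
    ring
  refine ⟨h, fun hz => ?_⟩
  rw [h]
  by_cases h3 : z₃ = 0
  · by_cases h1 : z₁ = 0
    · have h2 : z₂ ≠ 0 := fun h2 => hz (by simp [h1, h2, h3])
      positivity
    · positivity
  · positivity
end

section
/- Let δ ≠ 0 be a real number, and let H_1 be the 2×2 matrix with rows (2, δ), (δ, −2) and H_2 the 2×2 matrix with rows (2, 0), (0, −2) (these are the Hessians of g_1(x,y) = x² − y² + δxy and g_2(x,y) = x² − y²). Then for all (s_1, s_2) ∈ ℝ² with (s_1, s_2) ≠ (0,0), det(s_1 H_1 + s_2 H_2) = −4(s_1 + s_2)² − δ² s_1² < 0; in particular s_1 H_1 + s_2 H_2 is invertible for every nonzero (s_1, s_2), and hence (2, 4) is a good pair. -/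
noncomputable section

theorem aux_fderiv (d : ℝ) : fderiv ℝ (fun y : Fin 2 → ℝ => y 0 ^ 2 - y 1 ^ 2 + d * (y 0 * y 1)) =
    fun y => (2 * y 0 + d * y 1) • (ContinuousLinearMap.proj 0 : (Fin 2 → ℝ) →L[ℝ] ℝ) +
      (d * y 0 - 2 * y 1) • (ContinuousLinearMap.proj 1 : (Fin 2 → ℝ) →L[ℝ] ℝ) := by
  funext y
  have h0 : HasFDerivAt (fun y : Fin 2 → ℝ => y 0)
    (ContinuousLinearMap.proj 0 : (Fin 2 → ℝ) →L[ℝ] ℝ) y := hasFDerivAt_apply 0 y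
  have h1 : HasFDerivAt (fun y : Fin 2 → ℝ => y 1)
    (ContinuousLinearMap.proj 1 : (Fin 2 → ℝ) →L[ℝ] ℝ) y := hasFDerivAt_apply 1 y
  refine HasFDerivAt.fderiv ?_
  refine (((h0.pow 2).sub (h1.pow 2)).add ((h0.mul h1).const_mul d)).congr_fderiv ?_
  ext v
  simp
  ring

theorem aux_second (d : ℝ) (x v w : Fin 2 → ℝ) :
    iteratedFDeriv ℝ 2 (fun y : Fin 2 → ℝ => y 0 ^ 2 - y 1 ^ 2 + d * (y 0 * y 1)) x ![v, w] =
    (2 * v 0 + d * v 1) * w 0 + (d * v 0 - 2 * v 1) * w 1 := by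
  rw [iteratedFDeriv_two_apply, aux_fderiv]
  have h0 : HasFDerivAt (fun y : Fin 2 → ℝ => y 0)
    (ContinuousLinearMap.proj 0 : (Fin 2 → ℝ) →L[ℝ] ℝ) x := hasFDerivAt_apply 0 x
  have h1 : HasFDerivAt (fun y : Fin 2 → ℝ => y 1)
    (ContinuousLinearMap.proj 1 : (Fin 2 → ℝ) →L[ℝ] ℝ) x := hasFDerivAt_apply 1 x
  have := ((((h0.const_mul 2).add (h1.const_mul d)).smul_const
    (ContinuousLinearMap.proj 0 : (Fin 2 → ℝ) →L[ℝ] ℝ)).add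
    (((h0.const_mul d).sub (h1.const_mul 2)).smul_const
    (ContinuousLinearMap.proj 1 : (Fin 2 → ℝ) →L[ℝ] ℝ))).fderiv
  erw [this]
  simp

theorem stmt11 (δ : ℝ) (hδ : δ ≠ 0)
    (H₁ H₂ : Matrix (Fin 2) (Fin 2) ℝ)
    (hH₁ : H₁ = !![2, δ; δ, -2]) (hH₂ : H₂ = !![2, 0; 0, -2]) :
    (∀ s₁ s₂ : ℝ, (s₁, s₂) ≠ (0, 0) →
      (s₁ • H₁ + s₂ • H₂).det = -4 * (s₁ + s₂) ^ 2 - δ ^ 2 * s₁ ^ 2 ∧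
      (s₁ • H₁ + s₂ • H₂).det < 0 ∧
      IsUnit (s₁ • H₁ + s₂ • H₂)) ∧
    IsGoodPair 2 4 := by
  have key : ∀ s₁ s₂ : ℝ, (s₁, s₂) ≠ (0, 0) →
      (s₁ • H₁ + s₂ • H₂).det = -4 * (s₁ + s₂) ^ 2 - δ ^ 2 * s₁ ^ 2 ∧
      (s₁ • H₁ + s₂ • H₂).det < 0 ∧
      IsUnit (s₁ • H₁ + s₂ • H₂) := by
    intro s₁ s₂ hs
    have h1 : (s₁ • H₁ + s₂ • H₂).det = -4 * (s₁ + s₂) ^ 2 - δ ^ 2 * s₁ ^ 2 := by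
      subst hH₁ hH₂
      simp [Matrix.det_fin_two]
      ring
    have h2 : (s₁ • H₁ + s₂ • H₂).det < 0 := by
      rw [h1]
      by_cases h : s₁ = 0
      · subst h
        have : s₂ ≠ 0 := by
          rintro rfl
          exact hs rfl
        have : 0 < s₂ ^ 2 := by positivity
        nlinarith
      · have : 0 < δ ^ 2 * s₁ ^ 2 := by positivity
        nlinarith [sq_nonneg (s₁ + s₂)]
    exact ⟨h1, h2, (Matrix.isUnit_iff_isUnit_det _).2 (isUnit_iff_ne_zero.2 h2.ne)⟩
  refine ⟨key, ?_⟩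
  let g : (Fin 2 → ℝ) → (Fin 2 → ℝ) := fun y u =>
    y 0 ^ 2 - y 1 ^ 2 + (![δ, 0] : Fin 2 → ℝ) u * (y 0 * y 1)
  refine ⟨(Metric.ball 0 1 : Set (Fin 2 → ℝ)), g, Metric.isOpen_ball,
    (convex_ball _ _).isConnected ⟨0, by simp⟩, Metric.isBounded_ball, ?_, ?_⟩
  · apply ContDiff.contDiffOn
    rw [contDiff_pi]
    intro u
    change ContDiff ℝ 2 (fun y : Fin 2 → ℝ =>
      y 0 ^ 2 - y 1 ^ 2 + (![δ, 0] : Fin 2 → ℝ) u * (y 0 * y 1))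
    fun_prop
  · intro s hs x _
    have e : Lambda g s x = s 0 • H₁ + s 1 • H₂ := by
      subst hH₁ hH₂
      ext j i
      simp only [Lambda, secondPartial, g, Matrix.of_apply, aux_second, Fin.sum_univ_two]
      fin_cases i <;> fin_cases j <;> simp
    have := (key (s 0) (s 1) ?_).2.2
    · rw [← e] at this
      exact this
    · intro h
      apply hs
      rw [Prod.mk.injEq] at h
      ext i
      fin_cases i
      · exact h.1
      · exact h.2
end
end

section
/- Let t ≥ 2 be an integer and let δ_1,…,δ_t be nonzero real numbers. Define quadratic forms g_1, g_2 : ℝ^{2t} → ℝ, in coordinates (x_1, y_1, …, x_t, y_t), by g_1 = ∑_{u=1}^{t} (x_u² − y_u² + δ_u x_u y_u) and g_2 = ∑_{u=1}^{t} (x_u² − y_u²). Then for every (s_1, s_2) ∈ ℝ² with (s_1, s_2) ≠ (0,0), the 2t×2t matrix s_1 ∇²g_1 + s_2 ∇²g_2 (where ∇²g_u denotes the constant Hessian matrix of g_u) is invertible. In particular, (2, 2t + 2) is a good pair for every integer t ≥ 2. -/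
noncomputable section

/-- The Hessian matrix of a scalar function `g : ℝ^m → ℝ` at `x`. -/
def hessMatrix {m : ℕ} (g : (Fin m → ℝ) → ℝ) (x : Fin m → ℝ) :
    Matrix (Fin m) (Fin m) ℝ :=
  Matrix.of fun i j => iteratedFDeriv ℝ 2 g x ![Pi.single i 1, Pi.single j 1]

lemma aux_lt0 (t : ℕ) (u : Fin t) : 2 * (u : ℕ) < 2 * t := by
  have := u.isLt
  omega

lemma aux_lt1 (t : ℕ) (u : Fin t) : 2 * (u : ℕ) + 1 < 2 * t := by
  have := u.isLt
  omega

/-- The bilinear form attached to the diagonal-block quadratic form. -/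
def auxB (t : ℕ) (a : ℝ) (b : Fin t → ℝ) :
    (Fin (2 * t) → ℝ) →L[ℝ] (Fin (2 * t) → ℝ) →L[ℝ] ℝ :=
  ∑ u : Fin t,
    let p : (Fin (2 * t) → ℝ) →L[ℝ] ℝ :=
      ContinuousLinearMap.proj ⟨2 * (u : ℕ), aux_lt0 t u⟩
    let q : (Fin (2 * t) → ℝ) →L[ℝ] ℝ :=
      ContinuousLinearMap.proj ⟨2 * (u : ℕ) + 1, aux_lt1 t u⟩
    (a • p.smulRight p - a • q.smulRight q + b u • p.smulRight q)

lemma auxB_apply (t : ℕ) (a : ℝ) (b : Fin t → ℝ) (v w : Fin (2 * t) → ℝ) :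
    auxB t a b v w = ∑ u : Fin t,
      (a * (v ⟨2 * (u : ℕ), aux_lt0 t u⟩ * w ⟨2 * (u : ℕ), aux_lt0 t u⟩)
      - a * (v ⟨2 * (u : ℕ) + 1, aux_lt1 t u⟩
          * w ⟨2 * (u : ℕ) + 1, aux_lt1 t u⟩)
      + b u * (v ⟨2 * (u : ℕ), aux_lt0 t u⟩
          * w ⟨2 * (u : ℕ) + 1, aux_lt1 t u⟩)) := by
  simp [auxB]

lemma aux_hess {E : Type*} [NormedAddCommGroup E] [NormedSpace ℝ E]
    (B : E →L[ℝ] E →L[ℝ] ℝ) (g : E → ℝ) (hg : ∀ y, g y = B y y) (x v w : E) :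
    iteratedFDeriv ℝ 2 g x ![v, w] = B v w + B w v := by
  have h1 : fderiv ℝ g = fun y => (B + B.flip) y := by
    funext y
    have h := B.hasFDerivAt_of_bilinear (hasFDerivAt_id (𝕜 := ℝ) y) (hasFDerivAt_id (𝕜 := ℝ) y)
    have hg' : g = fun y => B (id y) (id y) := funext hg
    rw [hg', h.fderiv]
    ext z
    simp
  rw [iteratedFDeriv_two_apply, h1, ContinuousLinearMap.fderiv]
  simp

lemma aux_sum (m : ℕ) (f : (Fin m → ℝ) →L[ℝ] ℝ) (w : Fin m → ℝ) :
    ∑ j, f (Pi.single j 1) * w j = f w := by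
  conv_rhs => rw [pi_eq_sum_univ' w]
  simp [map_sum, mul_comm, Pi.single_apply, eq_comm]

lemma aux_unit (t : ℕ) (a : ℝ) (b : Fin t → ℝ) (h : ∀ u, a ≠ 0 ∨ b u ≠ 0)
    (M : Matrix (Fin (2 * t)) (Fin (2 * t)) ℝ)
    (hM : ∀ i j, M i j = auxB t a b (Pi.single i 1) (Pi.single j 1)
      + auxB t a b (Pi.single j 1) (Pi.single i 1)) : IsUnit M := by
  rw [← Matrix.mulVec_injective_iff_isUnit, ← Matrix.coe_mulVecLin, injective_iff_map_eq_zero]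
  intro w hw
  have key : ∀ i, auxB t a b (Pi.single i 1) w + auxB t a b w (Pi.single i 1) = 0 := by
    intro i
    have h1 := congrFun hw i
    simp only [Matrix.mulVecLin_apply, Matrix.mulVec, dotProduct, Pi.zero_apply, hM] at h1
    rw [← h1]
    exact (aux_sum (2 * t) ((auxB t a b + (auxB t a b).flip) (Pi.single i 1)) w).symm
  have k0 : ∀ u : Fin t, 2 * a * w ⟨2 * (u : ℕ), aux_lt0 t u⟩
      + b u * w ⟨2 * (u : ℕ) + 1, aux_lt1 t u⟩ = 0 := by
    intro u
    have h1 := key ⟨2 * (u : ℕ), aux_lt0 t u⟩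
    rw [auxB_apply, auxB_apply, ← Finset.sum_add_distrib, Finset.sum_eq_single u] at h1
    · simp [Pi.single_apply] at h1
      linarith
    · intro v _ hv
      have hv' : (v : ℕ) ≠ u := fun h => hv (Fin.ext h)
      have e1 : 2 * (v : ℕ) + 1 ≠ 2 * u := by omega
      simp [Pi.single_apply, hv', e1]
    · simp
  have k1 : ∀ u : Fin t, -(2 * a * w ⟨2 * (u : ℕ) + 1, aux_lt1 t u⟩)
      + b u * w ⟨2 * (u : ℕ), aux_lt0 t u⟩ = 0 := by
    intro u
    have h1 := key ⟨2 * (u : ℕ) + 1, aux_lt1 t u⟩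
    rw [auxB_apply, auxB_apply, ← Finset.sum_add_distrib, Finset.sum_eq_single u] at h1
    · simp [Pi.single_apply] at h1
      linarith
    · intro v _ hv
      have hv' : (v : ℕ) ≠ u := fun h => hv (Fin.ext h)
      have e1 : 2 * (v : ℕ) ≠ 2 * u + 1 := by omega
      simp [Pi.single_apply, hv', e1]
    · simp
  have hz : ∀ u : Fin t, w ⟨2 * (u : ℕ), aux_lt0 t u⟩ = 0 ∧
      w ⟨2 * (u : ℕ) + 1, aux_lt1 t u⟩ = 0 := by
    intro u
    have hp : 4 * a ^ 2 + b u ^ 2 ≠ 0 := by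
      rcases h u with h | h <;> positivity
    have e0 := k0 u
    have e1 := k1 u
    constructor
    · apply (mul_eq_zero.1 _).resolve_left hp
      linear_combination 2 * a * e0 + b u * e1
    · apply (mul_eq_zero.1 _).resolve_left hp
      linear_combination b u * e0 - 2 * a * e1
  funext i
  obtain ⟨i, hi⟩ := i
  have hi2 : i / 2 < t := by omega
  rcases Nat.even_or_odd' i with ⟨k, hk | hk⟩
  · subst hk
    exact (hz ⟨k, by omega⟩).1
  · subst hk
    exact (hz ⟨k, by omega⟩).2

theorem stmt12 (t : ℕ) (ht : 2 ≤ t) (δ : Fin t → ℝ) (hδ : ∀ u, δ u ≠ 0)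
    (g₁ g₂ : (Fin (2 * t) → ℝ) → ℝ)
    (hg₁ : ∀ x, g₁ x = ∑ u : Fin t,
      ((x ⟨2 * (u : ℕ), by have := u.isLt; omega⟩) ^ 2
        - (x ⟨2 * (u : ℕ) + 1, by have := u.isLt; omega⟩) ^ 2
        + δ u * (x ⟨2 * (u : ℕ), by have := u.isLt; omega⟩)
            * (x ⟨2 * (u : ℕ) + 1, by have := u.isLt; omega⟩)))
    (hg₂ : ∀ x, g₂ x = ∑ u : Fin t,
      ((x ⟨2 * (u : ℕ), by have := u.isLt; omega⟩) ^ 2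
        - (x ⟨2 * (u : ℕ) + 1, by have := u.isLt; omega⟩) ^ 2)) :
    (∀ s₁ s₂ : ℝ, (s₁, s₂) ≠ (0, 0) → ∀ x : Fin (2 * t) → ℝ,
      IsUnit (s₁ • hessMatrix g₁ x + s₂ • hessMatrix g₂ x)) ∧
    IsGoodPair 2 (2 * t + 2) := by
  have e₁ : ∀ y, g₁ y = auxB t 1 δ y y := by
    intro y
    rw [hg₁, auxB_apply]
    exact Finset.sum_congr rfl fun u _ => by ring
  have e₂ : ∀ y, g₂ y = auxB t 1 0 y y := by
    intro y
    rw [hg₂, auxB_apply]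
    exact Finset.sum_congr rfl fun u _ => by simp; ring
  have main : ∀ s₁ s₂ : ℝ, (s₁, s₂) ≠ (0, 0) → ∀ x : Fin (2 * t) → ℝ,
      IsUnit (s₁ • hessMatrix g₁ x + s₂ • hessMatrix g₂ x) := by
    intro s₁ s₂ hs x
    apply aux_unit t (s₁ + s₂) (fun u => s₁ * δ u)
    · intro u
      by_contra! hc
      have h1 : s₁ = 0 := (mul_eq_zero.1 hc.2).resolve_right (hδ u)
      exact hs (by simp [h1, show s₂ = 0 by linarith [hc.1]])
    · have hB : ∀ v w, auxB t (s₁ + s₂) (fun u => s₁ * δ u) v w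
          = s₁ * auxB t 1 δ v w + s₂ * auxB t 1 0 v w := by
        intro v w
        simp only [auxB_apply, Finset.mul_sum, ← Finset.sum_add_distrib]
        exact Finset.sum_congr rfl fun u _ => by simp; ring
      intro i j
      simp only [Matrix.add_apply, Matrix.smul_apply, hessMatrix, Matrix.of_apply,
        aux_hess _ _ e₁, aux_hess _ _ e₂, hB, smul_eq_mul]
      ring
  refine ⟨main, ?_⟩
  change ∃ (U : Set (Fin (2 * t) → ℝ)) (g : (Fin (2 * t) → ℝ) → (Fin 2 → ℝ)),
    IsOpen U ∧ IsConnected U ∧ Bornology.IsBounded U ∧ ContDiffOn ℝ 2 g U ∧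
    ∀ s : Fin 2 → ℝ, s ≠ 0 → ∀ x ∈ U, IsUnit (Lambda g s x)
  refine ⟨Metric.ball 0 1, fun x => ![g₁ x, g₂ x], Metric.isOpen_ball,
    ⟨⟨0, by simp⟩, (convex_ball _ _).isPreconnected⟩, Metric.isBounded_ball, ?_, ?_⟩
  · apply ContDiff.contDiffOn
    rw [contDiff_pi]
    intro i
    fin_cases i
    · change ContDiff ℝ 2 (fun x => g₁ x)
      simp only [hg₁]
      fun_prop
    · change ContDiff ℝ 2 (fun x => g₂ x)
      simp only [hg₂]
      fun_prop
  · intro s hs x _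
    have h := main (s 0) (s 1) (by
      intro h
      apply hs
      funext i
      fin_cases i
      · exact congrArg Prod.fst h
      · exact congrArg Prod.snd h) x
    rw [← Matrix.isUnit_transpose] at h
    convert h using 1
    ext i j
    simp [Lambda, secondPartial, hessMatrix, Fin.sum_univ_two]
end
end

section
/- Define quadratic forms g_1, g_2, g_3 : ℝ⁴ → ℝ by g_1(x) = (x_1² − x_2² + x_3² − x_4²)/2, g_2(x) = x_1 x_2 + x_3 x_4, and g_3(x) = x_1 x_3 + x_2 x_3 + x_2 x_4 − x_1 x_4. Then for every nonzero s = (s_1, s_2, s_3) ∈ ℝ³, the 4×4 matrix s_1 ∇²g_1 + s_2 ∇²g_2 + s_3 ∇²g_3 (with ∇²g_u the constant Hessian matrix of g_u) has determinant (s_1² + s_2²)² + 4 s_3⁴ > 0, and in particular is invertible. Consequently, (3, 7) is a good pair. -/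
noncomputable section

theorem hess_bilin {E : Type*} [NormedAddCommGroup E] [NormedSpace ℝ E]
    (B : E →L[ℝ] E →L[ℝ] ℝ) (g : E → ℝ) (hg : ∀ x, g x = B x x) (x v w : E) :
    iteratedFDeriv ℝ 2 g x ![v, w] = B v w + B w v := by
  have h1 : fderiv ℝ g = fun y => (B + B.flip) y := by
    funext y
    have : g = fun x => B x x := funext hg
    rw [this]
    have h := (B.hasFDerivAt (x := y)).clm_apply (hasFDerivAt_id (𝕜 := ℝ) y)
    have h2 := h.fderiv
    simp only [id] at h2
    rw [h2]
    ext z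
    simp
  rw [iteratedFDeriv_two_apply, h1, ContinuousLinearMap.fderiv]
  simp

def bil (A : Matrix (Fin 4) (Fin 4) ℝ) : (Fin 4 → ℝ) →L[ℝ] (Fin 4 → ℝ) →L[ℝ] ℝ :=
  ∑ i, ∑ j, A i j • (ContinuousLinearMap.proj (R := ℝ) (φ := fun _ : Fin 4 => ℝ) i).smulRight
    (ContinuousLinearMap.proj (R := ℝ) (φ := fun _ : Fin 4 => ℝ) j)

theorem bil_apply (A : Matrix (Fin 4) (Fin 4) ℝ) (x y : Fin 4 → ℝ) :
    bil A x y = ∑ i, ∑ j, A i j * (x i * y j) := by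
  simp [bil]

theorem hess_eq (A : Matrix (Fin 4) (Fin 4) ℝ) (g : (Fin 4 → ℝ) → ℝ)
    (hg : ∀ x, g x = ∑ i, ∑ j, A i j * (x i * x j)) (x : Fin 4 → ℝ) :
    hessMatrix g x = A + A.transpose := by
  ext i j
  simp only [hessMatrix, Matrix.of_apply]
  rw [hess_bilin (bil A) g (fun x => by rw [hg, bil_apply])]
  simp [bil_apply, Pi.single_apply]

theorem main_part (g₁ g₂ g₃ : (Fin 4 → ℝ) → ℝ)
    (hg₁ : ∀ x, g₁ x = ((x 0) ^ 2 - (x 1) ^ 2 + (x 2) ^ 2 - (x 3) ^ 2) / 2)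
    (hg₂ : ∀ x, g₂ x = x 0 * x 1 + x 2 * x 3)
    (hg₃ : ∀ x, g₃ x = x 0 * x 2 + x 1 * x 2 + x 1 * x 3 - x 0 * x 3) :
    (∀ s : Fin 3 → ℝ, s ≠ 0 → ∀ x : Fin 4 → ℝ,
      (s 0 • hessMatrix g₁ x + s 1 • hessMatrix g₂ x + s 2 • hessMatrix g₃ x).det
          = ((s 0) ^ 2 + (s 1) ^ 2) ^ 2 + 4 * (s 2) ^ 4 ∧
      0 < (s 0 • hessMatrix g₁ x + s 1 • hessMatrix g₂ x + s 2 • hessMatrix g₃ x).det ∧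
      IsUnit (s 0 • hessMatrix g₁ x + s 1 • hessMatrix g₂ x + s 2 • hessMatrix g₃ x)) := by
  intro s hs x
  have e1 := hess_eq !![1/2,0,0,0;0,-1/2,0,0;0,0,1/2,0;0,0,0,-1/2] g₁ (fun x => by
    rw [hg₁]; simp [Fin.sum_univ_four]; ring) x
  have e2 := hess_eq !![0,1,0,0;0,0,0,0;0,0,0,1;0,0,0,0] g₂ (fun x => by
    rw [hg₂]; simp [Fin.sum_univ_four]) x
  have e3 := hess_eq !![0,0,1,-1;0,0,1,1;0,0,0,0;0,0,0,0] g₃ (fun x => by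
    rw [hg₃]; simp [Fin.sum_univ_four]; ring) x
  have hdet : (s 0 • hessMatrix g₁ x + s 1 • hessMatrix g₂ x + s 2 • hessMatrix g₃ x).det
          = ((s 0) ^ 2 + (s 1) ^ 2) ^ 2 + 4 * (s 2) ^ 4 := by
    have hM : s 0 • hessMatrix g₁ x + s 1 • hessMatrix g₂ x + s 2 • hessMatrix g₃ x
        = !![s 0, s 1, s 2, -s 2; s 1, -s 0, s 2, s 2; s 2, s 2, s 0, s 1;
            -s 2, s 2, s 1, -s 0] := by
      rw [e1, e2, e3]
      ext i j
      fin_cases i <;> fin_cases j <;> simp <;> ring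
    rw [hM]
    simp [Matrix.det_succ_row_zero, Fin.sum_univ_succ, Fin.succAbove]
    ring
  have hpos : 0 < ((s 0) ^ 2 + (s 1) ^ 2) ^ 2 + 4 * (s 2) ^ 4 := by
    by_contra hn
    apply hs
    have h4 : 0 ≤ (s 2) ^ 4 := by positivity
    have h5 : 0 ≤ ((s 0) ^ 2 + (s 1) ^ 2) ^ 2 := by positivity
    have h6 : (s 2) ^ 4 = 0 := by linarith
    have h7 : ((s 0) ^ 2 + (s 1) ^ 2) ^ 2 = 0 := by linarith
    have h8 : s 2 = 0 := by simpa using h6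
    have h9 : (s 0) ^ 2 + (s 1) ^ 2 = 0 := by simpa using h7
    have h10 : s 0 = 0 := by nlinarith [sq_nonneg (s 0), sq_nonneg (s 1)]
    have h11 : s 1 = 0 := by nlinarith [sq_nonneg (s 0), sq_nonneg (s 1)]
    ext i
    fin_cases i <;> simp [h8, h10, h11]
  refine ⟨hdet, by rw [hdet]; exact hpos, ?_⟩
  rw [Matrix.isUnit_iff_isUnit_det, hdet]
  exact hpos.ne'.isUnit

theorem good_part : IsGoodPair 3 7 := by
  let g₁ : (Fin 4 → ℝ) → ℝ := fun x => ((x 0) ^ 2 - (x 1) ^ 2 + (x 2) ^ 2 - (x 3) ^ 2) / 2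
  let g₂ : (Fin 4 → ℝ) → ℝ := fun x => x 0 * x 1 + x 2 * x 3
  let g₃ : (Fin 4 → ℝ) → ℝ := fun x => x 0 * x 2 + x 1 * x 2 + x 1 * x 3 - x 0 * x 3
  have hm := main_part g₁ g₂ g₃ (fun _ => rfl) (fun _ => rfl) (fun _ => rfl)
  unfold IsGoodPair
  change ∃ (U : Set (Fin 4 → ℝ)) (g : (Fin 4 → ℝ) → (Fin 3 → ℝ)),
    IsOpen U ∧ IsConnected U ∧ Bornology.IsBounded U ∧ ContDiffOn ℝ 2 g U ∧
    ∀ s : Fin 3 → ℝ, s ≠ 0 → ∀ x ∈ U, IsUnit (Lambda g s x)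
  refine ⟨Metric.ball 0 1, fun x => ![g₁ x, g₂ x, g₃ x], Metric.isOpen_ball,
    (convex_ball _ _).isConnected ⟨0, by simp⟩, Metric.isBounded_ball, ?_, ?_⟩
  · apply ContDiff.contDiffOn
    rw [contDiff_pi]
    intro i
    fin_cases i
    · change ContDiff ℝ 2 g₁
      fun_prop
    · change ContDiff ℝ 2 g₂
      fun_prop
    · change ContDiff ℝ 2 g₃
      fun_prop
  · intro s hs x _
    have h := (hm s hs x).2.2
    have key : Lambda (fun x => ![g₁ x, g₂ x, g₃ x]) s x
      = (s 0 • hessMatrix g₁ x + s 1 • hessMatrix g₂ x + s 2 • hessMatrix g₃ x).transpose := by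
      ext i j
      simp [Lambda, secondPartial, hessMatrix, Fin.sum_univ_three]
    rw [key, Matrix.isUnit_transpose]
    exact h



theorem stmt13 (g₁ g₂ g₃ : (Fin 4 → ℝ) → ℝ)
    (hg₁ : ∀ x, g₁ x = ((x 0) ^ 2 - (x 1) ^ 2 + (x 2) ^ 2 - (x 3) ^ 2) / 2)
    (hg₂ : ∀ x, g₂ x = x 0 * x 1 + x 2 * x 3)
    (hg₃ : ∀ x, g₃ x = x 0 * x 2 + x 1 * x 2 + x 1 * x 3 - x 0 * x 3) :
    (∀ s : Fin 3 → ℝ, s ≠ 0 → ∀ x : Fin 4 → ℝ,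
      (s 0 • hessMatrix g₁ x + s 1 • hessMatrix g₂ x + s 2 • hessMatrix g₃ x).det
          = ((s 0) ^ 2 + (s 1) ^ 2) ^ 2 + 4 * (s 2) ^ 4 ∧
      0 < (s 0 • hessMatrix g₁ x + s 1 • hessMatrix g₂ x + s 2 • hessMatrix g₃ x).det ∧
      IsUnit (s 0 • hessMatrix g₁ x + s 1 • hessMatrix g₂ x + s 2 • hessMatrix g₃ x)) ∧
    IsGoodPair 3 7 := by
  exact ⟨main_part g₁ g₂ g₃ hg₁ hg₂ hg₃, good_part⟩
end
end

section
/- For every integer t ≥ 0, the pair (3, 7 + 4t) is a good pair; that is, there exist quadratic forms g_1, g_2, g_3 : ℝ^{4(t+1)} → ℝ such that for every nonzero s = (s_1, s_2, s_3) ∈ ℝ³ the constant symmetric matrix s_1 ∇²g_1 + s_2 ∇²g_2 + s_3 ∇²g_3 is invertible. -/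
noncomputable section

lemma hess_quad {m : ℕ} (A : Matrix (Fin m) (Fin m) ℝ) (x : Fin m → ℝ) (i j : Fin m) :
    iteratedFDeriv ℝ 2 (fun y : Fin m → ℝ => ∑ k, ∑ l, A k l * y k * y l) x
      ![Pi.single i 1, Pi.single j 1] = A i j + A j i := by
  have h1 : fderiv ℝ (fun y : Fin m → ℝ => ∑ k, ∑ l, A k l * y k * y l) =
      fun y => ∑ k, ∑ l, ((A k l * y k) • (ContinuousLinearMap.proj l : (Fin m → ℝ) →L[ℝ] ℝ) +
        y l • (A k l • (ContinuousLinearMap.proj k : (Fin m → ℝ) →L[ℝ] ℝ))) := by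
    funext y
    apply HasFDerivAt.fderiv
    refine HasFDerivAt.fun_sum fun k _ => HasFDerivAt.fun_sum fun l _ => ?_
    exact ((hasFDerivAt_apply k y).const_mul (A k l)).mul (hasFDerivAt_apply l y)
  have h2 : HasFDerivAt (fun y : Fin m → ℝ => ∑ k, ∑ l,
      ((A k l * y k) • (ContinuousLinearMap.proj l : (Fin m → ℝ) →L[ℝ] ℝ) +
        y l • (A k l • (ContinuousLinearMap.proj k : (Fin m → ℝ) →L[ℝ] ℝ))))
      (∑ k, ∑ l, (((A k l • (ContinuousLinearMap.proj k : (Fin m → ℝ) →L[ℝ] ℝ)).smulRight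
          (ContinuousLinearMap.proj l : (Fin m → ℝ) →L[ℝ] ℝ)) +
        ((ContinuousLinearMap.proj l : (Fin m → ℝ) →L[ℝ] ℝ).smulRight
          (A k l • (ContinuousLinearMap.proj k : (Fin m → ℝ) →L[ℝ] ℝ))))) x := by
    refine HasFDerivAt.fun_sum fun k _ => HasFDerivAt.fun_sum fun l _ => ?_
    have e1 := ((hasFDerivAt_apply (𝕜 := ℝ) k x).const_mul (A k l)).smul_const
      (ContinuousLinearMap.proj l : (Fin m → ℝ) →L[ℝ] ℝ)
    have e2 := (hasFDerivAt_apply (𝕜 := ℝ) l x).smul_const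
      (A k l • (ContinuousLinearMap.proj k : (Fin m → ℝ) →L[ℝ] ℝ))
    exact e1.add e2
  rw [iteratedFDeriv_two_apply, h1, h2.fderiv]
  simp [Pi.single_apply, Finset.sum_add_distrib]

def pauli (a b c : ℝ) : Matrix (Fin 4) (Fin 4) ℝ :=
  !![c, 0, a, b; 0, c, -b, a; a, -b, -c, 0; b, a, 0, -c]

lemma pauli_sq (a b c : ℝ) : pauli a b c * pauli a b c = (a^2+b^2+c^2) • 1 := by
  have h1 : (1 : Matrix (Fin 4) (Fin 4) ℝ) =
      !![1, 0, 0, 0; 0, 1, 0, 0; 0, 0, 1, 0; 0, 0, 0, 1] := by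
    ext i j
    fin_cases i <;> fin_cases j <;> rfl
  rw [h1]
  ext i j
  fin_cases i <;> fin_cases j <;>
    simp [pauli, Matrix.mul_apply, Fin.sum_univ_four] <;> ring

def bigM (t : ℕ) (a b c : ℝ) : Matrix (Fin (4 * (t + 1))) (Fin (4 * (t + 1))) ℝ :=
  Matrix.reindex finProdFinEquiv finProdFinEquiv
    (Matrix.kroneckerMap (· * ·) (pauli a b c) (1 : Matrix (Fin (t+1)) (Fin (t+1)) ℝ))

lemma bigM_sq (t : ℕ) (a b c : ℝ) : bigM t a b c * bigM t a b c = (a^2+b^2+c^2) • 1 := by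
  unfold bigM
  rw [Matrix.reindex_apply, Matrix.submatrix_mul_equiv, ← Matrix.mul_kronecker_mul, pauli_sq,
    Matrix.smul_kronecker, mul_one, Matrix.one_kronecker_one, Matrix.submatrix_smul,
    Pi.smul_apply, Pi.smul_apply, Matrix.submatrix_one_equiv]

lemma bigM_apply (t : ℕ) (a b c : ℝ) (i j) : bigM t a b c i j =
    pauli a b c (finProdFinEquiv.symm i).1 (finProdFinEquiv.symm j).1 *
    (1 : Matrix (Fin (t+1)) (Fin (t+1)) ℝ) (finProdFinEquiv.symm i).2 (finProdFinEquiv.symm j).2 := rfl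

lemma pauli_symm (a b c : ℝ) (i j) : pauli a b c i j = pauli a b c j i := by
  fin_cases i <;> fin_cases j <;> simp [pauli]

lemma pauli_lin (a b c : ℝ) (i j) : pauli a b c i j =
    a * pauli 1 0 0 i j + b * pauli 0 1 0 i j + c * pauli 0 0 1 i j := by
  fin_cases i <;> fin_cases j <;> simp [pauli]

lemma bigM_symm (t : ℕ) (a b c : ℝ) (i j) : bigM t a b c i j = bigM t a b c j i := by
  rw [bigM_apply, bigM_apply, pauli_symm, Matrix.one_apply, Matrix.one_apply]
  simp only [eq_comm]

lemma bigM_lin (t : ℕ) (a b c : ℝ) (i j) : bigM t a b c i j =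
    a * bigM t 1 0 0 i j + b * bigM t 0 1 0 i j + c * bigM t 0 0 1 i j := by
  simp only [bigM_apply]
  rw [pauli_lin]
  ring

lemma bigM_unit (t : ℕ) (s : Fin 3 → ℝ) (hs : s ≠ 0) :
    IsUnit ((2 : ℝ) • bigM t (s 0) (s 1) (s 2)) := by
  have hr : (s 0)^2 + (s 1)^2 + (s 2)^2 ≠ 0 := by
    intro h
    apply hs
    funext u
    fin_cases u <;> simp <;> nlinarith [sq_nonneg (s 0), sq_nonneg (s 1), sq_nonneg (s 2)]
  refine IsUnit.of_mul_eq_one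
    ((2 * ((s 0)^2 + (s 1)^2 + (s 2)^2))⁻¹ • bigM t (s 0) (s 1) (s 2)) ?_
  rw [smul_mul_smul_comm, bigM_sq, smul_smul]
  convert one_smul ℝ _
  field_simp

lemma exists_mats (m t : ℕ) (hm : m = 4 * (t + 1)) :
    ∃ A : Fin 3 → Matrix (Fin m) (Fin m) ℝ, ∀ s : Fin 3 → ℝ, s ≠ 0 →
      IsUnit (Matrix.of fun i j => ∑ u, s u * (A u i j + A u j i)) := by
  subst hm
  refine ⟨![bigM t 1 0 0, bigM t 0 1 0, bigM t 0 0 1], fun s hs => ?_⟩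
  convert bigM_unit t s hs using 1
  ext i j
  simp only [Matrix.of_apply, Fin.sum_univ_three, Matrix.smul_apply, smul_eq_mul,
    bigM_lin t (s 0) (s 1) (s 2)]
  change s 0 * (bigM t 1 0 0 i j + bigM t 1 0 0 j i) + s 1 * (bigM t 0 1 0 i j + bigM t 0 1 0 j i)
    + s 2 * (bigM t 0 0 1 i j + bigM t 0 0 1 j i) = _
  rw [bigM_symm t 1 0 0 j i, bigM_symm t 0 1 0 j i, bigM_symm t 0 0 1 j i]
  ring

theorem stmt14 (t : ℕ) :
    IsGoodPair 3 (7 + 4 * t) ∧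
    ∃ g₁ g₂ g₃ : (Fin (4 * (t + 1)) → ℝ) → ℝ,
      (∃ C : Matrix (Fin (4 * (t + 1))) (Fin (4 * (t + 1))) ℝ,
        ∀ x, g₁ x = ∑ i, ∑ j, C i j * x i * x j) ∧
      (∃ C : Matrix (Fin (4 * (t + 1))) (Fin (4 * (t + 1))) ℝ,
        ∀ x, g₂ x = ∑ i, ∑ j, C i j * x i * x j) ∧
      (∃ C : Matrix (Fin (4 * (t + 1))) (Fin (4 * (t + 1))) ℝ,
        ∀ x, g₃ x = ∑ i, ∑ j, C i j * x i * x j) ∧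
      ∀ s : Fin 3 → ℝ, s ≠ 0 → ∀ x : Fin (4 * (t + 1)) → ℝ,
        IsUnit (s 0 • hessMatrix g₁ x + s 1 • hessMatrix g₂ x + s 2 • hessMatrix g₃ x) := by
  constructor
  · obtain ⟨A, hA⟩ := exists_mats (7 + 4 * t - 3) t (by omega)
    refine ⟨Metric.ball 0 1, fun y u => ∑ k, ∑ l, A u k l * y k * y l, Metric.isOpen_ball,
      ⟨⟨0, by simp⟩, (convex_ball _ _).isPreconnected⟩, Metric.isBounded_ball, ?_, ?_⟩
    · apply ContDiff.contDiffOn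
      fun_prop
    · intro s hs x _
      convert hA s hs using 1
      ext i j
      simp only [Lambda, secondPartial, hess_quad, Matrix.of_apply]
      exact Finset.sum_congr rfl fun u _ => by ring
  · obtain ⟨A, hA⟩ := exists_mats _ t rfl
    refine ⟨_, _, _, ⟨A 0, fun x => rfl⟩, ⟨A 1, fun x => rfl⟩, ⟨A 2, fun x => rfl⟩, ?_⟩
    intro s hs x
    convert hA s hs using 1
    ext i j
    simp [hessMatrix, hess_quad, Fin.sum_univ_three]
end
end
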